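/- Suppose (A1)-(A3) hold and set Λ = Λ(M). Then for every sequence of points x_n ∈ ℤ_+^{Λ(M),d} with |x_n| → ∞ and x_n/|x_n| → M/|M|, and for every w ∈ ℤ^d with w^Λ = 0, the following ratio limit holds: lim_{δ→0} liminf_{n→∞} inf_{x∈ℤ_+^{Λ,d}, |x|<δ|x_n|} G_Λ(x+w, x_n)/G_Λ(x, x_n) = lim_{δ→0} limsup_{n→∞} sup_{x∈ℤ_+^{Λ,d}, |x|<δ|x_n|} G_Λ(x+w, x_n)/G_Λ(x, x_n) = 1. -/

import Mathlib

open Filter Topology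

attribute [local instance] Classical.propDecidable

noncomputable section

variable {V : Type*} [AddCommGroup V]

/-- `n`-step transition kernel of the random walk with step distribution `μ`,
killed upon leaving the set `A` : `kern μ A n x y = P_x(S n = y, τ_A > n)`,
where `τ_A` is the first exit time from `A`. -/
def kern (μ : V → ℝ) (A : Set V) : ℕ → V → V → ℝ
  | 0 => fun x y => if x = y ∧ x ∈ A then 1 else 0
  | n + 1 => fun x y => ∑' z : V, (if x ∈ A then μ (z - x) else 0) * kern μ A n z y

/-- Green function of the walk killed outside `A`. -/
def green (μ : V → ℝ) (A : Set V) (x y : V) : ℝ :=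
  ∑' n : ℕ, kern μ A n x y

/-- `E_x [ g(S τ) ; S τ ∈ B, τ < ∞ ]`, where `τ` is the first exit time from `A`. -/
def exitExp (μ : V → ℝ) (A B : Set V) (g : V → ℝ) (x : V) : ℝ :=
  ∑' n : ℕ, ∑' z : V, kern μ A n x z *
    ∑' y : V, (if y ∉ A ∧ y ∈ B then μ (y - z) else 0) * g y

/-- `ℝ≥0∞`-valued version of `exitExp`. -/
def exitExpE (μ : V → ℝ) (A B : Set V) (g : V → ℝ) (x : V) : ENNReal :=
  ∑' n : ℕ, ∑' z : V, ENNReal.ofReal (kern μ A n x z) *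
    ∑' y : V, ENNReal.ofReal ((if y ∉ A ∧ y ∈ B then μ (y - z) else 0) * g y)

/-- `P_x(S t = y for some t ≥ 0)` for the walk killed outside `A`
(first passage decomposition). -/
def hitProb (μ : V → ℝ) (A : Set V) (x y : V) : ℝ :=
  (if x = y ∧ x ∈ A then 1 else 0) +
    ∑' n : ℕ, ∑' z : V, kern μ (A \ {y}) n x z * (if y ∈ A then μ (y - z) else 0)

/-- `h` is (strictly speaking, satisfies the mean value property of a) harmonic
function on `A` for the walk with step distribution `μ` killed outside `A`. -/
def HarmOn (μ : V → ℝ) (A : Set V) (h : V → ℝ) : Prop :=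
  ∀ x ∈ A, h x = ∑' y : V, if y ∈ A then μ (y - x) * h y else 0

/-- Irreducibility of the walk killed outside `A`. -/
def Irred (μ : V → ℝ) (A : Set V) : Prop :=
  ∀ x ∈ A, ∀ x' ∈ A, ∃ (k : ℕ) (c : ℕ → V), c 0 = x ∧ c k = x' ∧
    (∀ j ≤ k, c j ∈ A) ∧ ∀ j < k, 0 < μ (c (j + 1) - c j)

/-- A sequence `xs` is fundamental for the walk killed outside `A` :
the Martin kernels `G(x, xs n)/G(x₀, xs n)` converge for every `x ∈ A`. -/
def Fundamental (μ : V → ℝ) (A : Set V) (x₀ : V) (xs : ℕ → V) : Prop :=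
  ∀ x ∈ A, ∃ L : ℝ,
    Tendsto (fun n => green μ A x (xs n) / green μ A x₀ (xs n)) atTop (𝓝 L)

/-- ℓ¹-norm of an integer vector. -/
def znorm {ι : Type*} [Fintype ι] (x : ι → ℤ) : ℝ := ∑ i, |(x i : ℝ)|

/-- ℓ¹-norm of a real vector. -/
def rnorm {ι : Type*} [Fintype ι] (q : ι → ℝ) : ℝ := ∑ i, |q i|

variable {d : ℕ}

/-- `ℤ^{Λ,d}_+ = {x ∈ ℤ^d : xⁱ > 0 for all i ∈ Λ}`. -/
def posDom (Λ : Set (Fin d)) : Set (Fin d → ℤ) := {x | ∀ i ∈ Λ, 0 < x i}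

/-- `ℤ^d_+ = {x ∈ ℤ^d : xⁱ > 0 for all i}`. -/
def posAll : Set (Fin d → ℤ) := {x | ∀ i, 0 < x i}

/-- `a · z` for `a ∈ ℝ^d`, `z ∈ ℤ^d`. -/
def dotZ (a : Fin d → ℝ) (z : Fin d → ℤ) : ℝ := ∑ i, a i * (z i : ℝ)

/-- `a · q` for `a, q ∈ ℝ^d`. -/
def dotR (a q : Fin d → ℝ) : ℝ := ∑ i, a i * q i

/-- jump generating function `φ(a) = Σ_z μ(z) exp(a·z)` (valued in `ℝ≥0∞`). -/
def phiE (μ : (Fin d → ℤ) → ℝ) (a : Fin d → ℝ) : ENNReal :=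
  ∑' z : Fin d → ℤ, ENNReal.ofReal (μ z * Real.exp (dotZ a z))

/-- `D = {a ∈ ℝ^d : φ(a) ≤ 1}`. -/
def Dset (μ : (Fin d → ℤ) → ℝ) : Set (Fin d → ℝ) := {a | phiE μ a ≤ 1}

/-- mean vector `M = Σ_z μ(z) z`. -/
def Mvec (μ : (Fin d → ℤ) → ℝ) : Fin d → ℝ := fun i => ∑' z : Fin d → ℤ, μ z * (z i : ℝ)

/-- `Λ(M) = {i : Mⁱ = 0}`. -/
def LambdaM (μ : (Fin d → ℤ) → ℝ) : Set (Fin d) := {i | Mvec μ i = 0}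

/-- Assumption (A1) : irreducibility on every `ℤ^{Λ,d}_+`. -/
def A1 (μ : (Fin d → ℤ) → ℝ) : Prop := ∀ Λ : Set (Fin d), Irred μ (posDom Λ)

/-- Assumption (A2) : `φ` is finite on a neighborhood of the set `D`. -/
def A2 (μ : (Fin d → ℤ) → ℝ) : Prop :=
  ∃ U : Set (Fin d → ℝ), IsOpen U ∧ Dset μ ⊆ U ∧ ∀ a ∈ U, phiE μ a ≠ ⊤

/-- Assumption (A3) : `M ≠ 0`. -/
def A3 (μ : (Fin d → ℤ) → ℝ) : Prop := Mvec μ ≠ 0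

/-- projection `x ↦ x^Λ`. -/
def projL (Λ : Set (Fin d)) (x : Fin d → ℤ) : ↥Λ → ℤ := fun i => x (i : Fin d)

/-- jump distribution `μ_Λ(v) = Σ_{x : x^Λ = v} μ(x)` of the projected walk. -/
def muL (μ : (Fin d → ℤ) → ℝ) (Λ : Set (Fin d)) (v : ↥Λ → ℤ) : ℝ :=
  ∑' x : Fin d → ℤ, if projL Λ x = v then μ x else 0

/-- `ℤ^Λ_+`. -/
def posL (Λ : Set (Fin d)) : Set (↥Λ → ℤ) := {u | ∀ i, 0 < u i}

end

/-! ### Kernel operators on `ℝ≥0∞`-valued functions -/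

section KernelOperators

open scoped ENNReal

variable {X : Type*}

/-- The operator `f ↦ (x ↦ ∑ z, p x z * f z)` attached to a nonnegative kernel `p`. -/
noncomputable def kernOp (p : X → X → ℝ≥0∞) : Module.End ℝ≥0∞ (X → ℝ≥0∞) where
  toFun f x := ∑' z, p x z * f z
  map_add' f g := by
    ext x
    simp [mul_add, ENNReal.tsum_add]
  map_smul' c f := by
    ext x
    simp only [Pi.smul_apply, smul_eq_mul, RingHom.id_apply, ← ENNReal.tsum_mul_left]
    exact tsum_congr fun z => by ring

theorem kernOp_apply (p : X → X → ℝ≥0∞) (f : X → ℝ≥0∞) (x : X) :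
    kernOp p f x = ∑' z, p x z * f z := rfl

theorem end_mono (L : Module.End ℝ≥0∞ (X → ℝ≥0∞)) {f g : X → ℝ≥0∞} (h : f ≤ g) :
    L f ≤ L g := by
  have : g = f + (g - f) := (add_tsub_cancel_of_le h).symm
  rw [this, map_add]
  exact le_self_add

theorem end_pow_le (L : Module.End ℝ≥0∞ (X → ℝ≥0∞)) {h : X → ℝ≥0∞} {b : ℝ≥0∞}
    (hL : L h ≤ b • h) (n : ℕ) : (L ^ n) h ≤ b ^ n • h := by
  induction n with
  | zero => simp
  | succ n ih =>
    calc (L ^ (n + 1)) h = (L ^ n) (L h) := by rw [pow_succ]; rfl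
      _ ≤ (L ^ n) (b • h) := end_mono _ hL
      _ = b • (L ^ n) h := map_smul _ _ _
      _ ≤ b • (b ^ n • h) := by gcongr
      _ = b ^ (n + 1) • h := by rw [smul_smul, pow_succ']

theorem kernOp_one : kernOp (fun x z : X => if x = z then 1 else 0) = 1 := by
  ext f x
  simp [kernOp_apply]

theorem kernOp_mul (p q : X → X → ℝ≥0∞) :
    kernOp p * kernOp q = kernOp (fun x z => ∑' y, p x y * q y z) := by
  refine LinearMap.ext fun f => funext fun x => ?_
  simp only [Module.End.mul_apply, kernOp_apply, ← ENNReal.tsum_mul_left,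
    ← ENNReal.tsum_mul_right]
  rw [ENNReal.tsum_comm]
  exact tsum_congr fun _ => tsum_congr fun _ => by ring

theorem kernOp_add (p q : X → X → ℝ≥0∞) :
    kernOp p + kernOp q = kernOp (fun x z => p x z + q x z) := by
  refine LinearMap.ext fun f => funext fun x => ?_
  simp [kernOp_apply, add_mul, ENNReal.tsum_add]

theorem kernOp_smul (c : ℝ≥0∞) (p : X → X → ℝ≥0∞) :
    c • kernOp p = kernOp (fun x z => c * p x z) := by
  refine LinearMap.ext fun f => funext fun x => ?_
  simp [kernOp_apply, mul_assoc, ENNReal.tsum_mul_left]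

theorem exists_kernOp_pow (p : X → X → ℝ≥0∞) (n : ℕ) : ∃ r, kernOp p ^ n = kernOp r := by
  induction n with
  | zero => exact ⟨_, by rw [pow_zero, kernOp_one]⟩
  | succ n ih =>
    obtain ⟨r, hr⟩ := ih
    exact ⟨_, by rw [pow_succ, hr, kernOp_mul]⟩

theorem kernOp_single (p : X → X → ℝ≥0∞) (x z : X) :
    kernOp p (fun u => if u = z then 1 else 0) x = p x z := by
  simp [kernOp_apply]

theorem kernOp_le_smul_one {p : X → X → ℝ≥0∞} {b : ℝ≥0∞} (h : ∀ x, ∑' z, p x z ≤ b) :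
    kernOp p 1 ≤ b • 1 := fun x => by
  simpa [kernOp_apply] using h x

/-- The lazy version `(1 + P) / 2` of an operator. -/
noncomputable def lazyOp (P : Module.End ℝ≥0∞ (X → ℝ≥0∞)) : Module.End ℝ≥0∞ (X → ℝ≥0∞) :=
  (2⁻¹ : ℝ≥0∞) • (1 + P)

theorem lazyOp_pow_apply (P : Module.End ℝ≥0∞ (X → ℝ≥0∞)) (n : ℕ) (f : X → ℝ≥0∞) (x : X) :
    (lazyOp P ^ n) f x = ∑ j ∈ Finset.range (n + 1),
      (2⁻¹ : ℝ≥0∞) ^ n * (n.choose j : ℝ≥0∞) * (P ^ j) f x := by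
  have h1 : lazyOp P ^ n = (2⁻¹ : ℝ≥0∞) ^ n •
      ∑ j ∈ Finset.range (n + 1), (n.choose j : ℝ≥0∞) • P ^ j := by
    rw [lazyOp, smul_pow, add_comm, (Commute.one_right P).add_pow]
    congr 1
    refine Finset.sum_congr rfl fun j _ => ?_
    rw [one_pow, mul_one, Nat.cast_smul_eq_nsmul, nsmul_eq_mul]
    exact (Nat.cast_commute _ _).symm
  rw [h1]
  simp [LinearMap.sum_apply, Finset.sum_apply, Finset.mul_sum, mul_assoc]

theorem tsum_choose_mul_inv_two_pow (j : ℕ) :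
    ∑' n : ℕ, (2⁻¹ : ℝ≥0∞) ^ n * (n.choose j : ℝ≥0∞) = 2 := by
  have h := hasSum_choose_mul_geometric_of_norm_lt_one (𝕜 := ℝ) j (r := 1 / 2) (by norm_num)
  have h2 : HasSum (fun n : ℕ => (1 / 2 : ℝ) ^ n * (n.choose j : ℝ)) 2 := by
    rw [← hasSum_nat_add_iff' j]
    have : ∑ i ∈ Finset.range j, (1 / 2 : ℝ) ^ i * (i.choose j : ℝ) = 0 :=
      Finset.sum_eq_zero fun i hi => by
        rw [Nat.choose_eq_zero_of_lt (Finset.mem_range.1 hi)]; simp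
    rw [this, sub_zero]
    have h1 : (1 / 2 : ℝ) ^ j * (1 / (1 - 1 / 2) ^ (j + 1)) = 2 := by
      rw [pow_succ]
      norm_num
      field_simp
    have h2 := h.mul_left ((1 / 2 : ℝ) ^ j)
    rw [h1] at h2
    refine h2.congr_fun fun n => ?_
    rw [pow_add, mul_comm (_ ^ n), mul_assoc, mul_comm (_ ^ n)]
  have h3 : ∀ n : ℕ, (2⁻¹ : ℝ≥0∞) ^ n * (n.choose j : ℝ≥0∞) =
      ENNReal.ofReal ((1 / 2 : ℝ) ^ n * (n.choose j : ℝ)) := fun n => by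
    rw [ENNReal.ofReal_mul (by positivity), ENNReal.ofReal_pow (by norm_num),
      ENNReal.ofReal_natCast, one_div, ENNReal.ofReal_inv_of_pos (by norm_num)]
    simp
  simp_rw [h3]
  rw [← ENNReal.ofReal_tsum_of_nonneg (fun n => by positivity) h2.summable, h2.tsum_eq]
  simp

theorem tsum_lazyOp_pow (P : Module.End ℝ≥0∞ (X → ℝ≥0∞)) (f : X → ℝ≥0∞) (x : X) :
    ∑' n, (lazyOp P ^ n) f x = 2 * ∑' n, (P ^ n) f x := by
  have h : ∀ n, (lazyOp P ^ n) f x =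
      ∑' j, (2⁻¹ : ℝ≥0∞) ^ n * (n.choose j : ℝ≥0∞) * (P ^ j) f x := fun n => by
    rw [lazyOp_pow_apply, tsum_eq_sum]
    intro j hj
    rw [Finset.mem_range, not_lt] at hj
    rw [Nat.choose_eq_zero_of_lt (by omega)]
    simp
  simp_rw [h]
  rw [ENNReal.tsum_comm, ← ENNReal.tsum_mul_left]
  exact tsum_congr fun j => by rw [ENNReal.tsum_mul_right, tsum_choose_mul_inv_two_pow]

theorem lazyOp_apply (P : Module.End ℝ≥0∞ (X → ℝ≥0∞)) (f : X → ℝ≥0∞) :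
    lazyOp P f = (2⁻¹ : ℝ≥0∞) • (f + P f) := rfl

theorem lazyOp_le_smul {P : Module.End ℝ≥0∞ (X → ℝ≥0∞)} {h : X → ℝ≥0∞} {b : ℝ≥0∞}
    (hb : 1 ≤ b) (hP : P h ≤ b • h) : lazyOp P h ≤ b • h := by
  rw [lazyOp_apply]
  calc (2⁻¹ : ℝ≥0∞) • (h + P h) ≤ (2⁻¹ : ℝ≥0∞) • (b • h + b • h) := by
        gcongr
        exact fun x => le_mul_of_one_le_left' hb
    _ = b • h := by
        rw [← two_smul ℝ≥0∞ (b • h), smul_smul,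
          ENNReal.inv_mul_cancel (by norm_num) (by norm_num), one_smul]

theorem le_lazyOp_pow {P : Module.End ℝ≥0∞ (X → ℝ≥0∞)} {τ : X → X} {k : ℕ} {c : ℝ≥0∞}
    (hc : c ≤ 1) {f : X → ℝ≥0∞} {x : X} (hk : c * f (τ x) ≤ (P ^ k) f x) :
    (2⁻¹ : ℝ≥0∞) ^ (k + 1) * c * (f x + f (τ x)) ≤ (lazyOp P ^ k) f x := by
  have key : ∀ j ≤ k, (2⁻¹ : ℝ≥0∞) ^ k * (P ^ j) f x ≤ (lazyOp P ^ k) f x := by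
    intro j hj
    rw [lazyOp_pow_apply]
    refine le_trans ?_ (Finset.single_le_sum
      (f := fun j => (2⁻¹ : ℝ≥0∞) ^ k * (k.choose j : ℝ≥0∞) * (P ^ j) f x)
      (fun _ _ => zero_le) (Finset.mem_range.2 (Nat.lt_succ_of_le hj)))
    gcongr
    refine le_mul_of_one_le_right' ?_
    exact_mod_cast Nat.choose_pos hj
  have h0 := key 0 (Nat.zero_le _)
  have h1 := key k le_rfl
  rw [pow_zero, Module.End.one_apply] at h0
  calc (2⁻¹ : ℝ≥0∞) ^ (k + 1) * c * (f x + f (τ x))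
      = 2⁻¹ * (c * ((2⁻¹ : ℝ≥0∞) ^ k * f x) + (2⁻¹ : ℝ≥0∞) ^ k * (c * f (τ x))) := by
        rw [pow_succ]; ring
    _ ≤ 2⁻¹ * ((lazyOp P ^ k) f x + (lazyOp P ^ k) f x) := by
        gcongr
        · exact (mul_le_of_le_one_left' hc).trans h0
        · exact le_trans (by gcongr) h1
    _ = (lazyOp P ^ k) f x := by
        rw [← two_mul, ← mul_assoc, ENNReal.inv_mul_cancel (by norm_num) (by norm_num), one_mul]

end KernelOperators

/-! ### Comparison of translates for powers of kernels with a Bernoulli part -/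

section RatioLimit

open scoped ENNReal

variable {X : Type*}

theorem exists_exp_add_exp_lt_two {σ : ℝ} (hσ : 0 < σ) :
    ∃ s > 0, Real.exp s + Real.exp (-(s * (1 + σ))) < 2 := by
  have h1 : HasDerivAt (fun s : ℝ => Real.exp s + Real.exp (-(s * (1 + σ))))
      (Real.exp 0 + Real.exp (-(0 * (1 + σ))) * (-(1 * (1 + σ)))) 0 :=
    (Real.hasDerivAt_exp 0).add (((hasDerivAt_id (0 : ℝ)).mul_const (1 + σ)).neg.exp)
  have h2 : Real.exp 0 + Real.exp (-(0 * (1 + σ))) * (-(1 * (1 + σ))) < 0 := by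
    simp [hσ]
  have h3 := (hasDerivAt_iff_tendsto_slope.1 h1).eventually (gt_mem_nhds h2)
  have h4 := (h3.filter_mono (nhdsWithin_mono (0 : ℝ)
    (fun x (hx : x ∈ Set.Ioi (0 : ℝ)) => ne_of_gt hx))).and self_mem_nhdsWithin
  obtain ⟨s, hs, hs0⟩ := h4.exists
  refine ⟨s, hs0, ?_⟩
  rw [slope_def_field, sub_zero, div_neg_iff] at hs
  have h5 : (0 : ℝ) < s := hs0
  rcases hs with hs | hs
  · linarith [hs.2]
  · have := hs.1
    norm_num at this
    linarith

theorem choose_le_mul_choose_succ_add {σ s : ℝ} (hσ : 0 < σ) (hs : 0 < s) (m j : ℕ)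
    (hj : j ≤ m) :
    (m.choose j : ℝ) ≤ (1 + σ) * (m.choose (j + 1) : ℝ) +
      Real.exp s * (m.choose j * (Real.exp s ^ j * Real.exp (-(s * (1 + σ))) ^ (m - j))) := by
  have hchoose : (m.choose (j + 1) : ℝ) * (j + 1) = m.choose j * (m - j) := by
    have := Nat.choose_succ_right_eq m j
    rw [← Nat.cast_sub hj]
    exact_mod_cast this
  have hc : (0 : ℝ) ≤ m.choose j := Nat.cast_nonneg _
  by_cases h : (j + 1 : ℝ) ≤ (1 + σ) * (m - j)
  · have h1 : (m.choose j : ℝ) ≤ (1 + σ) * (m.choose (j + 1) : ℝ) := by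
      have hj1 : (0 : ℝ) < j + 1 := by positivity
      refine le_of_mul_le_mul_right ?_ hj1
      calc (m.choose j : ℝ) * (j + 1) ≤ m.choose j * ((1 + σ) * (m - j)) := by gcongr
        _ = (1 + σ) * (m.choose (j + 1) : ℝ) * (j + 1) := by
          rw [mul_assoc, hchoose]; ring
    have h2 : (0 : ℝ) ≤ Real.exp s *
        (m.choose j * (Real.exp s ^ j * Real.exp (-(s * (1 + σ))) ^ (m - j))) := by positivity
    linarith
  · have h1 : Real.exp s *
        (m.choose j * (Real.exp s ^ j * Real.exp (-(s * (1 + σ))) ^ (m - j))) =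
        m.choose j * Real.exp (s * ((j + 1) - (1 + σ) * (m - j))) := by
      rw [← Real.exp_nat_mul, ← Real.exp_nat_mul, Nat.cast_sub hj, mul_left_comm,
        ← Real.exp_add, ← Real.exp_add]
      congr 2
      ring
    rw [h1]
    have h2 : 1 ≤ Real.exp (s * ((j + 1) - (1 + σ) * (m - j))) :=
      Real.one_le_exp (mul_nonneg hs.le (by linarith))
    have h3 : (0 : ℝ) ≤ (1 + σ) * (m.choose (j + 1) : ℝ) := by positivity
    nlinarith

theorem exists_sum_choose_shift_le {σ : ℝ} (hσ : 0 < σ) :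
    ∃ C ρ : ℝ≥0∞, C ≠ ⊤ ∧ ρ < 1 ∧ ∀ (m : ℕ) (g : ℕ → ℝ≥0∞) (B : ℝ≥0∞), (∀ j, g j ≤ B) →
      ∑ j ∈ Finset.range (m + 1), (m.choose j : ℝ≥0∞) * g (j + 1) ≤
        ENNReal.ofReal (1 + σ) * ∑ j ∈ Finset.range (m + 1), (m.choose j : ℝ≥0∞) * g j +
          C * (2 * ρ) ^ m * B := by
  obtain ⟨s, hs, hs2⟩ := exists_exp_add_exp_lt_two hσ
  set a := Real.exp s
  set b := Real.exp (-(s * (1 + σ)))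
  have ha : 0 < a := Real.exp_pos _
  have hb : 0 < b := Real.exp_pos _
  refine ⟨ENNReal.ofReal a, ENNReal.ofReal ((a + b) / 2), ENNReal.ofReal_ne_top, ?_, ?_⟩
  · rw [ENNReal.ofReal_lt_one]
    linarith
  intro m g B hg
  have hρ : (2 : ℝ≥0∞) * ENNReal.ofReal ((a + b) / 2) = ENNReal.ofReal (a + b) := by
    rw [← ENNReal.ofReal_ofNat, ← ENNReal.ofReal_mul (by norm_num)]
    congr 1
    ring
  have hpt : ∀ j ∈ Finset.range (m + 1), (m.choose j : ℝ≥0∞) * g (j + 1) ≤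
      ENNReal.ofReal (1 + σ) * ((m.choose (j + 1) : ℝ≥0∞) * g (j + 1)) +
        ENNReal.ofReal a * ENNReal.ofReal (m.choose j * (a ^ j * b ^ (m - j))) * B := by
    intro j hj
    have h1 := ENNReal.ofReal_le_ofReal (choose_le_mul_choose_succ_add hσ hs m j
      (Nat.lt_succ_iff.1 (Finset.mem_range.1 hj)))
    rw [ENNReal.ofReal_add (by positivity) (by positivity), ENNReal.ofReal_mul (by positivity),
      ENNReal.ofReal_mul (p := Real.exp s) (by positivity), ENNReal.ofReal_natCast,
      ENNReal.ofReal_natCast] at h1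
    calc (m.choose j : ℝ≥0∞) * g (j + 1)
        ≤ (ENNReal.ofReal (1 + σ) * (m.choose (j + 1) : ℝ≥0∞) +
          ENNReal.ofReal a * ENNReal.ofReal (m.choose j * (a ^ j * b ^ (m - j)))) * g (j + 1) := by
          gcongr
      _ ≤ _ := by
          rw [add_mul, mul_assoc]
          gcongr
          exact hg _
  refine (Finset.sum_le_sum hpt).trans ?_
  rw [Finset.sum_add_distrib, ← Finset.mul_sum, ← Finset.sum_mul, ← Finset.mul_sum]
  refine add_le_add (mul_le_mul_right ?_ _) (mul_le_mul_left (mul_le_mul_right ?_ _) _)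
  · rw [Finset.sum_range_succ, Nat.choose_succ_self, Finset.sum_range_succ']
    simp
  · rw [hρ, ← ENNReal.ofReal_sum_of_nonneg (fun _ _ => by positivity),
      ← ENNReal.ofReal_pow (by positivity), add_pow]
    refine ENNReal.ofReal_le_ofReal (le_of_eq (Finset.sum_congr rfl fun j _ => ?_))
    ring

theorem exists_pow_comp_le {σ : ℝ} (hσ : 0 < σ) : ∃ C ρ : ℝ≥0∞, C ≠ ⊤ ∧ ρ < 1 ∧
    ∀ (T R : Module.End ℝ≥0∞ (X → ℝ≥0∞)) (τ : X → X) (ε β : ℝ≥0∞), Commute T R →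
      (∀ f x, T f x = f (τ x)) → R 1 ≤ β • 1 → ∀ (f : X → ℝ≥0∞) (n : ℕ) (x : X), f ≤ 1 →
        ((ε • (1 + T) + R) ^ n) f (τ x) ≤
          ENNReal.ofReal (1 + σ) * ((ε • (1 + T) + R) ^ n) f x +
            C * (2 * ε * ρ + β) ^ n := by
  obtain ⟨C, ρ, hC, hρ, H⟩ := exists_sum_choose_shift_le hσ
  refine ⟨C, ρ, hC, hρ, ?_⟩
  intro T R τ ε β hcomm hT hR f n x hf
  have hTpow : ∀ (j : ℕ) (g : X → ℝ≥0∞) (x : X), (T ^ j) g x = g (τ^[j] x) := by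
    intro j
    induction j with
    | zero => simp
    | succ j ih =>
      intro g x
      rw [pow_succ, Module.End.mul_apply, ih, hT, Function.iterate_succ_apply']
  have hbin : ∀ (m : ℕ) (g : X → ℝ≥0∞) (x : X), ((1 + T) ^ m) g x =
      ∑ j ∈ Finset.range (m + 1), (m.choose j : ℝ≥0∞) * g (τ^[j] x) := by
    intro m g x
    have h1 : (1 + T) ^ m = ∑ j ∈ Finset.range (m + 1), (m.choose j : ℝ≥0∞) • T ^ j := by
      rw [add_comm, (Commute.one_right T).add_pow]
      refine Finset.sum_congr rfl fun j _ => ?_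
      rw [one_pow, mul_one, Nat.cast_smul_eq_nsmul, nsmul_eq_mul]
      exact (Nat.cast_commute _ _).symm
    rw [h1]
    simp [LinearMap.sum_apply, Finset.sum_apply, hTpow]
  have hexp : ∀ y, ((ε • (1 + T) + R) ^ n) f y = ∑ m ∈ Finset.range (n + 1),
      (n.choose m : ℝ≥0∞) * ε ^ m * ((1 + T) ^ m) ((R ^ (n - m)) f) y := by
    intro y
    have hc : Commute (ε • (1 + T)) R :=
      Commute.smul_left ((Commute.one_left R).add_left hcomm) ε
    have h1 : (ε • (1 + T) + R) ^ n = ∑ m ∈ Finset.range (n + 1),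
        ((n.choose m : ℝ≥0∞) * ε ^ m) • ((1 + T) ^ m * R ^ (n - m)) := by
      rw [hc.add_pow]
      refine Finset.sum_congr rfl fun m _ => ?_
      rw [smul_pow, smul_mul_assoc, mul_smul, Nat.cast_smul_eq_nsmul, nsmul_eq_mul]
      exact (Nat.cast_commute _ _).symm
    rw [h1]
    simp [LinearMap.sum_apply, Finset.sum_apply]
  have hmain : ∀ m ∈ Finset.range (n + 1),
      (n.choose m : ℝ≥0∞) * ε ^ m * ((1 + T) ^ m) ((R ^ (n - m)) f) (τ x) ≤
      ENNReal.ofReal (1 + σ) *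
        ((n.choose m : ℝ≥0∞) * ε ^ m * ((1 + T) ^ m) ((R ^ (n - m)) f) x) +
      C * ((2 * ε * ρ) ^ m * β ^ (n - m) * (n.choose m : ℝ≥0∞)) := by
    intro m _
    have hg : ∀ y, (R ^ (n - m)) f y ≤ β ^ (n - m) := fun y => by
      have := ((end_mono _ hf).trans (end_pow_le R hR (n - m))) y
      simpa using this
    have h1 := H m (fun j => (R ^ (n - m)) f (τ^[j] x)) _ fun j => hg _
    rw [hbin, hbin]
    simp only [Function.iterate_succ_apply] at h1
    refine (mul_le_mul_right h1 ((n.choose m : ℝ≥0∞) * ε ^ m)).trans (le_of_eq ?_)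
    rw [mul_pow, mul_pow, mul_pow]
    ring
  rw [hexp, hexp, add_pow, Finset.mul_sum, Finset.mul_sum, ← Finset.sum_add_distrib]
  exact Finset.sum_le_sum hmain

/-- If `P ^ k` dominates a multiple of a translation commuting with the kernel, then the powers of
the lazy operator are asymptotically invariant under this translation, up to an exponentially
small error. -/
theorem exists_lazyOp_pow_comp_le {p : X → X → ℝ≥0∞} (τ : Equiv.Perm X)
    (hp : ∀ x, ∑' z, p x z ≤ 1) (hτ : ∀ x z, p (τ x) (τ z) = p x z) {k : ℕ} {c : ℝ≥0∞}
    (hc : c ≠ 0) (hk : ∀ f x, c * f (τ x) ≤ (kernOp p ^ k) f x) {σ : ℝ} (hσ : 0 < σ) :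
    ∃ C ρ : ℝ≥0∞, C ≠ ⊤ ∧ ρ < 1 ∧ ∀ (n : ℕ) (f : X → ℝ≥0∞) (x : X), f ≤ 1 →
      (lazyOp (kernOp p) ^ (k * n)) f (τ x) ≤
        ENNReal.ofReal (1 + σ) * (lazyOp (kernOp p) ^ (k * n)) f x + C * ρ ^ n := by
  rcases isEmpty_or_nonempty X with hX | ⟨⟨x₀⟩⟩
  · exact ⟨0, 0, by simp, by simp, fun _ _ x => (hX.false x).elim⟩
  set P := kernOp p
  set T : Module.End ℝ≥0∞ (X → ℝ≥0∞) := LinearMap.funLeft ℝ≥0∞ ℝ≥0∞ τ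
  have hT : ∀ f x, T f x = f (τ x) := fun _ _ => rfl
  have hcommk : ∀ q : X → X → ℝ≥0∞, (∀ x z, q (τ x) (τ z) = q x z) → Commute T (kernOp q) := by
    intro q hq
    refine LinearMap.ext fun f => funext fun x => ?_
    rw [Module.End.mul_apply, Module.End.mul_apply, hT, kernOp_apply, kernOp_apply,
      ← Equiv.tsum_eq τ]
    exact tsum_congr fun z => by rw [hq, hT]
  have hP1 : P 1 ≤ (1 : ℝ≥0∞) • 1 := kernOp_le_smul_one hp
  have hc1 : c ≤ 1 := by
    have h1 := hk 1 x₀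
    have h2 := end_pow_le P hP1 k x₀
    simp only [one_pow, one_smul, Pi.one_apply, mul_one] at h1 h2
    exact h1.trans h2
  obtain ⟨ε, hε0, hε⟩ : ∃ ε : ℝ≥0∞, ε ≠ 0 ∧
      ∀ f x, ε * (f x + f (τ x)) ≤ (lazyOp P ^ k) f x :=
    ⟨_, mul_ne_zero (pow_ne_zero _ (by simp)) hc, fun f x => le_lazyOp_pow hc1 (hk f x)⟩
  obtain ⟨r, hr⟩ : ∃ r, lazyOp P ^ k = kernOp r := by
    rw [lazyOp, ← kernOp_one, kernOp_add, kernOp_smul]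
    exact exists_kernOp_pow _ _
  have hrle : ∀ x z, ε * ((if x = z then 1 else 0) + (if τ x = z then 1 else 0)) ≤ r x z := by
    intro x z
    have := hε (fun u => if u = z then 1 else 0) x
    rwa [hr, kernOp_single] at this
  have hrinv : ∀ x z, r (τ x) (τ z) = r x z := by
    intro x z
    have hcomm : Commute T (kernOp r) := by
      rw [← hr]
      exact (Commute.smul_right ((Commute.one_right T).add_right (hcommk p hτ)) _).pow_right k
    have h1 := congrFun (congrArg (fun L => L (fun u => if u = τ z then 1 else 0)) hcomm.eq) x
    simp only [Module.End.mul_apply, hT, kernOp_single] at h1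
    rw [h1]
    have h2 : T (fun u => if u = τ z then (1 : ℝ≥0∞) else 0) = fun u => if u = z then 1 else 0 := by
      ext u
      simp [hT]
    rw [h2, kernOp_single]
  set e : X → X → ℝ≥0∞ :=
    fun x z => ε * ((if x = z then 1 else 0) + (if τ x = z then 1 else 0)) with he
  set R := kernOp fun x z => r x z - e x z with hRdef
  have hKe : kernOp e = ε • (1 + T) := by
    refine LinearMap.ext fun f => funext fun x => ?_
    simp [he, kernOp_apply, add_mul, mul_add, ENNReal.tsum_add, hT]
  have hK : lazyOp P ^ k = ε • (1 + T) + R := by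
    rw [hr, hRdef, ← hKe, kernOp_add]
    congr 1
    ext x z
    exact (add_tsub_cancel_of_le (hrle x z)).symm
  have hcommR : Commute T R := hcommk _ fun x z => by
    simp [hrinv, he]
  have hK1 : lazyOp P ^ k • 1 ≤ (1 : X → ℝ≥0∞) := by
    have := end_pow_le (lazyOp P) (lazyOp_le_smul le_rfl hP1) k
    simpa using this
  have hsum : ∀ x, 2 * ε + R 1 x ≤ 1 := fun x => by
    have h1 := hK1 x
    rw [hK] at h1
    simp only [Module.End.smul_def, LinearMap.add_apply, LinearMap.smul_apply, Pi.add_apply,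
      Pi.smul_apply, Module.End.one_apply, hT, Pi.one_apply, smul_eq_mul] at h1
    rwa [one_add_one_eq_two, mul_comm ε] at h1
  have h2ε : 2 * ε ≤ 1 := le_self_add.trans (hsum x₀)
  have h2εt : 2 * ε ≠ ⊤ := ne_top_of_le_ne_top ENNReal.one_ne_top h2ε
  obtain ⟨C, ρ, hC, hρ, H⟩ := exists_pow_comp_le (X := X) hσ
  refine ⟨C, 2 * ε * ρ + (1 - 2 * ε), hC, ?_, ?_⟩
  · calc 2 * ε * ρ + (1 - 2 * ε) < 2 * ε * 1 + (1 - 2 * ε) := by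
          refine ENNReal.add_lt_add_right (by simp) ?_
          exact ENNReal.mul_lt_mul_right (mul_ne_zero two_ne_zero hε0) h2εt hρ
      _ = 1 := by rw [mul_one, add_tsub_cancel_of_le h2ε]
  · intro n f x hf
    rw [pow_mul, hK]
    refine H T R τ ε (1 - 2 * ε) hcommR hT (fun x => ?_) f n x hf
    have := ENNReal.le_sub_of_add_le_left h2εt (hsum x)
    simpa using this

end RatioLimit

/-! ### The walk killed outside `A` as a kernel operator -/

section KilledWalk

open scoped ENNReal

variable {V : Type*} [AddCommGroup V]

/-- Transition operator, on functions on `A`, of the walk killed outside `A`. -/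
noncomputable def killedOp (μ : V → ℝ) (A : Set V) : Module.End ℝ≥0∞ (A → ℝ≥0∞) :=
  kernOp fun x z => ENNReal.ofReal (μ (z.1 - x.1))

/-- Indicator of the point `y`. -/
noncomputable def pointInd {X : Type*} (y : X) : X → ℝ≥0∞ := fun u => if u = y then 1 else 0

/-- Green function `x ↦ G(x, y)` of the killed walk, valued in `ℝ≥0∞`. -/
noncomputable def greenE (μ : V → ℝ) (A : Set V) (y : A) (x : A) : ℝ≥0∞ :=
  ∑' n, (killedOp μ A ^ n) (pointInd y) x

theorem killedOp_apply (μ : V → ℝ) (A : Set V) (f : A → ℝ≥0∞) (x : A) :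
    killedOp μ A f x = ∑' z : A, ENNReal.ofReal (μ (z.1 - x.1)) * f z := rfl

theorem pointInd_le_one {X : Type*} (y : X) : pointInd y ≤ 1 := fun u => by
  simp only [pointInd, Pi.one_apply]
  split_ifs <;> simp

theorem tsum_ofReal_sub {μ : V → ℝ} (hnn : ∀ z, 0 ≤ μ z) (hsum : HasSum μ 1) (x : V) :
    ∑' z, ENNReal.ofReal (μ (z - x)) = 1 := by
  have h : ∑' z, ENNReal.ofReal (μ (z - x)) = ∑' v, ENNReal.ofReal (μ v) :=
    Equiv.tsum_eq (Equiv.subRight x) fun v => ENNReal.ofReal (μ v)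
  rw [h, ← ENNReal.ofReal_tsum_of_nonneg hnn hsum.summable, hsum.tsum_eq, ENNReal.ofReal_one]

theorem tsum_killed_le_one {μ : V → ℝ} (hnn : ∀ z, 0 ≤ μ z) (hsum : HasSum μ 1) (A : Set V)
    (x : A) : ∑' z : A, ENNReal.ofReal (μ (z.1 - x.1)) ≤ 1 := by
  rw [← tsum_ofReal_sub hnn hsum x.1]
  exact ENNReal.tsum_comp_le_tsum_of_injective Subtype.val_injective
    fun z => ENNReal.ofReal (μ (z - x.1))

theorem killedOp_one_le {μ : V → ℝ} (hnn : ∀ z, 0 ≤ μ z) (hsum : HasSum μ 1) (A : Set V) :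
    killedOp μ A 1 ≤ (1 : ℝ≥0∞) • 1 :=
  kernOp_le_smul_one (tsum_killed_le_one hnn hsum A)

theorem killedOp_pow_pointInd_le_one {μ : V → ℝ} (hnn : ∀ z, 0 ≤ μ z) (hsum : HasSum μ 1)
    (A : Set V) (n : ℕ) (x y : A) : (killedOp μ A ^ n) (pointInd y) x ≤ 1 := by
  have := ((end_mono _ (pointInd_le_one y)).trans
    (end_pow_le _ (killedOp_one_le hnn hsum A) n)) x
  simpa using this

theorem kern_eq_zero (μ : V → ℝ) {A : Set V} (n : ℕ) {x : V} (hx : x ∉ A) (y : V) :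
    kern μ A n x y = 0 := by
  cases n <;> simp [kern, hx]

theorem kern_eq_toReal {μ : V → ℝ} (hnn : ∀ z, 0 ≤ μ z) (hsum : HasSum μ 1) (A : Set V)
    (n : ℕ) (x y : A) : kern μ A n x y = ((killedOp μ A ^ n) (pointInd y) x).toReal := by
  induction n generalizing x with
  | zero =>
    by_cases h : x = y
    · simp [kern, pointInd, h]
    · have : ¬ (x : V) = y := fun h' => h (Subtype.ext h')
      simp [kern, pointInd, h, this]
  | succ n ih =>
    have h1 : kern μ A (n + 1) x y = ∑' z : A, μ (z.1 - x.1) * kern μ A n z y := by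
      simp only [kern, x.2, if_true]
      refine (tsum_subtype_eq_of_support_subset
        (f := fun z : V => μ (z - x.1) * kern μ A n z y) fun z hz => ?_).symm
      by_contra hzA
      exact hz (by simp [kern_eq_zero μ n hzA])
    rw [h1, pow_succ', Module.End.mul_apply, killedOp_apply, ENNReal.tsum_toReal_eq fun z => ?_]
    · refine tsum_congr fun z => ?_
      rw [ih, ENNReal.toReal_mul, ENNReal.toReal_ofReal (hnn _)]
    · exact ENNReal.mul_ne_top ENNReal.ofReal_ne_top
        (ne_top_of_le_ne_top ENNReal.one_ne_top (killedOp_pow_pointInd_le_one hnn hsum A n z y))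

theorem green_eq_toReal {μ : V → ℝ} (hnn : ∀ z, 0 ≤ μ z) (hsum : HasSum μ 1) (A : Set V)
    (x y : A) : green μ A x y = (greenE μ A y x).toReal := by
  rw [green, greenE, ENNReal.tsum_toReal_eq fun n => ne_top_of_le_ne_top ENNReal.one_ne_top
    (killedOp_pow_pointInd_le_one hnn hsum A n x y)]
  exact tsum_congr fun n => kern_eq_toReal hnn hsum A n x y

theorem killedOp_pow_greenE_le (μ : V → ℝ) (A : Set V) (k : ℕ) (y : A) :
    (killedOp μ A ^ k) (greenE μ A y) ≤ greenE μ A y := by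
  intro x
  have h1 : (killedOp μ A ^ k) (greenE μ A y) x =
      ∑' n, (killedOp μ A ^ (k + n)) (pointInd y) x := by
    obtain ⟨r, hr⟩ : ∃ r, killedOp μ A ^ k = kernOp r := exists_kernOp_pow _ k
    simp only [pow_add, Module.End.mul_apply, hr, kernOp_apply, greenE,
      ← ENNReal.tsum_mul_left]
    exact ENNReal.tsum_comm
  rw [h1]
  exact ENNReal.tsum_comp_le_tsum_of_injective (add_right_injective k)
    fun n => (killedOp μ A ^ n) (pointInd y) x

theorem one_le_greenE_self (μ : V → ℝ) (A : Set V) (y : A) : 1 ≤ greenE μ A y y := by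
  refine le_trans ?_ (ENNReal.le_tsum 0)
  simp [pointInd]

end KilledWalk

/-! ### Exponential moments -/

section Moments

open scoped ENNReal

variable {d : ℕ} {μ : (Fin d → ℤ) → ℝ}

theorem znorm_nonneg (x : Fin d → ℤ) : 0 ≤ znorm x :=
  Finset.sum_nonneg fun _ _ => abs_nonneg _

theorem abs_le_znorm (x : Fin d → ℤ) (i : Fin d) : |(x i : ℝ)| ≤ znorm x :=
  Finset.single_le_sum (f := fun i => |(x i : ℝ)|) (fun _ _ => abs_nonneg _) (Finset.mem_univ i)

theorem abs_le_rnorm (a : Fin d → ℝ) (i : Fin d) : |a i| ≤ rnorm a :=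
  Finset.single_le_sum (f := fun i => |a i|) (fun _ _ => abs_nonneg _) (Finset.mem_univ i)

theorem znorm_add_le (x y : Fin d → ℤ) : znorm (x + y) ≤ znorm x + znorm y := by
  rw [znorm, znorm, znorm, ← Finset.sum_add_distrib]
  refine Finset.sum_le_sum fun i _ => ?_
  simpa using abs_add_le (x i : ℝ) (y i)

theorem abs_dotZ_le {a : Fin d → ℝ} {r : ℝ} (ha : ∀ i, |a i| ≤ r) (z : Fin d → ℤ) :
    |dotZ a z| ≤ r * znorm z := by
  rw [dotZ, znorm, Finset.mul_sum]
  refine (Finset.abs_sum_le_sum_abs _ _).trans (Finset.sum_le_sum fun i _ => ?_)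
  rw [abs_mul]
  exact mul_le_mul_of_nonneg_right (ha i) (abs_nonneg _)

theorem dotZ_sub (a : Fin d → ℝ) (x y : Fin d → ℤ) : dotZ a (x - y) = dotZ a x - dotZ a y := by
  simp [dotZ, mul_sub, Finset.sum_sub_distrib]

theorem dotZ_smul (s : ℝ) (a : Fin d → ℝ) (x : Fin d → ℤ) :
    dotZ (fun i => s * a i) x = s * dotZ a x := by
  simp [dotZ, Finset.mul_sum, mul_assoc]

theorem exists_dotZ_sign_eq (r : ℝ) (z : Fin d → ℤ) :
    ∃ e : Fin d → Bool, dotZ (fun i => if e i then r else -r) z = r * znorm z := by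
  refine ⟨fun i => decide (0 ≤ z i), ?_⟩
  rw [dotZ, znorm, Finset.mul_sum]
  refine Finset.sum_congr rfl fun i _ => ?_
  by_cases h : 0 ≤ z i
  · have : (0 : ℝ) ≤ z i := by exact_mod_cast h
    simp [h, abs_of_nonneg this]
  · have : (z i : ℝ) ≤ 0 := by exact_mod_cast (not_le.1 h).le
    simp [h, abs_of_nonpos this]

theorem exists_summable_exp (hnn : ∀ z, 0 ≤ μ z) (hsum : HasSum μ 1) (hA2 : A2 μ) :
    ∃ r > 0, Summable fun z => μ z * Real.exp (r * znorm z) := by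
  obtain ⟨U, hU, hD, hfin⟩ := hA2
  have h0 : (0 : Fin d → ℝ) ∈ U := by
    refine hD ?_
    simp only [Dset, Set.mem_ofPred_eq, phiE, dotZ, Pi.zero_apply, zero_mul,
      Finset.sum_const_zero, Real.exp_zero, mul_one]
    rw [← ENNReal.ofReal_tsum_of_nonneg hnn hsum.summable, hsum.tsum_eq, ENNReal.ofReal_one]
  obtain ⟨r, hr, hball⟩ := Metric.isOpen_iff.1 hU 0 h0
  refine ⟨r / 2, by positivity, ?_⟩
  have hsume : ∀ e : Fin d → Bool,
      Summable fun z => μ z * Real.exp (dotZ (fun i => if e i then r / 2 else -(r / 2)) z) := by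
    intro e
    have hmem : (fun i => if e i then r / 2 else -(r / 2)) ∈ U := by
      refine hball ?_
      rw [Metric.mem_ball, dist_zero_right]
      refine lt_of_le_of_lt ((pi_norm_le_iff_of_nonneg (r := r / 2) (by positivity)).2
        fun i => ?_) (by linarith)
      split_ifs <;> simp [abs_of_pos hr]
    have h1 := ENNReal.summable_toReal (hfin _ hmem)
    refine h1.congr fun z => ?_
    rw [ENNReal.toReal_ofReal (mul_nonneg (hnn z) (Real.exp_pos _).le)]
  refine Summable.of_nonneg_of_le (fun z => mul_nonneg (hnn z) (Real.exp_pos _).le) (fun z => ?_)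
    (summable_sum fun e (_ : e ∈ Finset.univ) => hsume e)
  obtain ⟨e, he⟩ := exists_dotZ_sign_eq (r / 2) z
  rw [← he]
  exact Finset.single_le_sum
    (f := fun e => μ z * Real.exp (dotZ (fun i => if e i then r / 2 else -(r / 2)) z))
    (fun e _ => mul_nonneg (hnn z) (Real.exp_pos _).le) (Finset.mem_univ e)

theorem sq_le_mul_exp {r x : ℝ} (hr : 0 < r) (hx : 0 ≤ x) :
    x ^ 2 ≤ 2 / r ^ 2 * Real.exp (r * x) := by
  have h := Real.quadratic_le_exp_of_nonneg (mul_nonneg hr.le hx)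
  rw [div_mul_eq_mul_div, le_div_iff₀ (by positivity)]
  nlinarith [mul_nonneg hr.le hx]

theorem summable_sq_mul_exp (hnn : ∀ z, 0 ≤ μ z) {r : ℝ} (hr : 0 < r)
    (hsr : Summable fun z => μ z * Real.exp (r * znorm z)) :
    Summable fun z => μ z * (znorm z ^ 2 * Real.exp (r / 2 * znorm z)) := by
  refine Summable.of_nonneg_of_le
    (fun z => mul_nonneg (hnn z) (mul_nonneg (sq_nonneg _) (Real.exp_pos _).le)) (fun z => ?_)
    (hsr.mul_left (2 / (r / 2) ^ 2))
  have h1 := sq_le_mul_exp (half_pos hr) (znorm_nonneg z)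
  calc μ z * (znorm z ^ 2 * Real.exp (r / 2 * znorm z))
      ≤ μ z * (2 / (r / 2) ^ 2 * Real.exp (r / 2 * znorm z) * Real.exp (r / 2 * znorm z)) := by
        have := hnn z
        gcongr
    _ = 2 / (r / 2) ^ 2 * (μ z * Real.exp (r * znorm z)) := by
        rw [mul_assoc, ← Real.exp_add]
        ring_nf

theorem summable_mul_sq (hnn : ∀ z, 0 ≤ μ z) {r : ℝ} (hr : 0 < r)
    (hsr : Summable fun z => μ z * Real.exp (r * znorm z)) (i : Fin d) :
    Summable fun z => μ z * (z i : ℝ) ^ 2 := by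
  refine Summable.of_nonneg_of_le (fun z => mul_nonneg (hnn z) (sq_nonneg _)) (fun z => ?_)
    (summable_sq_mul_exp hnn hr hsr)
  refine mul_le_mul_of_nonneg_left ?_ (hnn z)
  calc (z i : ℝ) ^ 2 = |(z i : ℝ)| ^ 2 := (sq_abs _).symm
    _ ≤ znorm z ^ 2 := by gcongr; exact abs_le_znorm z i
    _ ≤ _ := le_mul_of_one_le_right (sq_nonneg _)
      (Real.one_le_exp (mul_nonneg (half_pos hr).le (znorm_nonneg z)))

theorem summable_mul_coord (hnn : ∀ z, 0 ≤ μ z) (hsum : HasSum μ 1) {r : ℝ} (hr : 0 < r)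
    (hsr : Summable fun z => μ z * Real.exp (r * znorm z)) (i : Fin d) :
    Summable fun z => μ z * (z i : ℝ) := by
  refine Summable.of_norm_bounded (hsum.summable.add (summable_mul_sq hnn hr hsr i)) fun z => ?_
  rw [Real.norm_eq_abs, abs_mul, abs_of_nonneg (hnn z), ← mul_one_add]
  refine mul_le_mul_of_nonneg_left ?_ (hnn z)
  nlinarith [sq_abs (z i : ℝ), sq_nonneg (|(z i : ℝ)| - 1)]

theorem hasSum_Mvec (hnn : ∀ z, 0 ≤ μ z) (hsum : HasSum μ 1) {r : ℝ} (hr : 0 < r)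
    (hsr : Summable fun z => μ z * Real.exp (r * znorm z)) (i : Fin d) :
    HasSum (fun z => μ z * (z i : ℝ)) (Mvec μ i) :=
  (summable_mul_coord hnn hsum hr hsr i).hasSum

theorem rnorm_pos {a : Fin d → ℝ} (ha : a ≠ 0) : 0 < rnorm a := by
  obtain ⟨i, hi⟩ := Function.ne_iff.1 ha
  exact (abs_pos.2 hi).trans_le (abs_le_rnorm a i)

theorem sum_sq_pos {a : Fin d → ℝ} (ha : a ≠ 0) : 0 < ∑ i, a i ^ 2 := by
  obtain ⟨i, hi⟩ := Function.ne_iff.1 ha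
  exact Finset.sum_pos' (fun _ _ => sq_nonneg _) ⟨i, Finset.mem_univ i, sq_pos_of_ne_zero hi⟩

theorem phiE_ne_top (hnn : ∀ z, 0 ≤ μ z) {r : ℝ}
    (hsr : Summable fun z => μ z * Real.exp (r * znorm z)) {a : Fin d → ℝ}
    (ha : ∀ i, |a i| ≤ r) : phiE μ a ≠ ⊤ := by
  have h1 : ∑' z, ENNReal.ofReal (μ z * Real.exp (r * znorm z)) ≠ ⊤ := hsr.tsum_ofReal_ne_top
  refine ne_top_of_le_ne_top h1 (ENNReal.tsum_le_tsum fun z => ENNReal.ofReal_le_ofReal ?_)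
  exact mul_le_mul_of_nonneg_left
    (Real.exp_le_exp.2 ((le_abs_self _).trans (abs_dotZ_le ha z))) (hnn z)

theorem exp_le_one_add_add_sq (u : ℝ) : Real.exp u ≤ 1 + u + u ^ 2 * Real.exp |u| := by
  have h := Complex.norm_exp_sub_sum_le_norm_mul_exp (u : ℂ) 2
  have h1 : Complex.exp u - ∑ m ∈ Finset.range 2, (u : ℂ) ^ m / m.factorial =
      ((Real.exp u - (1 + u) : ℝ) : ℂ) := by
    simp [Finset.sum_range_succ]
  rw [h1, Complex.norm_real, Complex.norm_real, Real.norm_eq_abs, Real.norm_eq_abs, sq_abs] at h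
  linarith [le_abs_self (Real.exp u - (1 + u))]

theorem exists_phiE_lt_one (hnn : ∀ z, 0 ≤ μ z) (hsum : HasSum μ 1) (hA2 : A2 μ) (hA3 : A3 μ) :
    ∃ a : Fin d → ℝ, phiE μ a < 1 := by
  obtain ⟨r, hr, hsr⟩ := exists_summable_exp hnn hsum hA2
  set M := Mvec μ with hM
  set m := rnorm M
  have hm : 0 < m := rnorm_pos hA3
  set q := ∑ i, M i ^ 2 with hq
  have hqpos : 0 < q := sum_sq_pos hA3
  set K := ∑' z, μ z * (znorm z ^ 2 * Real.exp (r / 2 * znorm z))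
  have hK := (summable_sq_mul_exp hnn hr hsr).hasSum
  have hK0 : 0 ≤ K := tsum_nonneg fun z =>
    mul_nonneg (hnn z) (mul_nonneg (sq_nonneg _) (Real.exp_pos _).le)
  have hdot : HasSum (fun z => μ z * dotZ M z) q := by
    have h1 := hasSum_sum fun i (_ : i ∈ Finset.univ) =>
      (hasSum_Mvec hnn hsum hr hsr i).mul_left (M i)
    have h2 : ∑ i, M i * Mvec μ i = q := Finset.sum_congr rfl fun i _ => (sq _).symm
    rw [h2] at h1
    refine h1.congr_fun fun z => ?_
    rw [dotZ, Finset.mul_sum]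
    exact Finset.sum_congr rfl fun i _ => by ring
  obtain ⟨s, hs, hs1, hs2⟩ : ∃ s > 0, s * m ≤ r / 2 ∧ s * (m ^ 2 * K) < q := by
    refine ⟨min (r / 2 / m) (q / (m ^ 2 * K + 1)), by positivity, ?_, ?_⟩
    · rw [← le_div_iff₀ hm]
      exact min_le_left _ _
    · calc _ ≤ q / (m ^ 2 * K + 1) * (m ^ 2 * K) := by gcongr; exact min_le_right _ _
        _ < q := by
          rw [div_mul_eq_mul_div, div_lt_iff₀ (by positivity)]
          nlinarith
  refine ⟨fun i => -s * M i, ?_⟩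
  have hbound : ∀ z, μ z * Real.exp (dotZ (fun i => -s * M i) z) ≤
      μ z + -s * (μ z * dotZ M z) +
        s ^ 2 * m ^ 2 * (μ z * (znorm z ^ 2 * Real.exp (r / 2 * znorm z))) := by
    intro z
    have hz := znorm_nonneg z
    have h1 : |dotZ M z| ≤ m * znorm z := abs_dotZ_le (abs_le_rnorm M) z
    have h2 : |-s * dotZ M z| ≤ r / 2 * znorm z := by
      rw [abs_mul, abs_neg, abs_of_pos hs]
      calc s * |dotZ M z| ≤ s * (m * znorm z) := by gcongr
        _ = s * m * znorm z := by ring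
        _ ≤ _ := by gcongr
    have h3 : (-s * dotZ M z) ^ 2 ≤ s ^ 2 * m ^ 2 * znorm z ^ 2 := by
      rw [mul_pow, neg_sq, mul_assoc, ← mul_pow m, ← sq_abs (dotZ M z)]
      gcongr
    rw [dotZ_smul]
    have h4 : Real.exp (-s * dotZ M z) ≤ 1 + -s * dotZ M z +
        s ^ 2 * m ^ 2 * znorm z ^ 2 * Real.exp (r / 2 * znorm z) := by
      refine (exp_le_one_add_add_sq _).trans ?_
      gcongr
    calc _ ≤ μ z * _ := mul_le_mul_of_nonneg_left h4 (hnn z)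
      _ = _ := by ring
  have hS := (hsum.add (hdot.mul_left (-s))).add (hK.mul_left (s ^ 2 * m ^ 2))
  calc phiE μ (fun i => -s * M i) ≤ ENNReal.ofReal (1 + -s * q + s ^ 2 * m ^ 2 * K) := by
        rw [phiE, ← hS.tsum_eq, ENNReal.ofReal_tsum_of_nonneg (fun z => ?_) hS.summable]
        · exact ENNReal.tsum_le_tsum fun z => ENNReal.ofReal_le_ofReal (hbound z)
        · exact le_trans (mul_nonneg (hnn z) (Real.exp_pos _).le) (hbound z)
    _ < 1 := by
        rw [ENNReal.ofReal_lt_one]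
        nlinarith

end Moments

/-! ### Exponential upper bounds -/

section UpperBounds

open scoped ENNReal

variable {d : ℕ} {μ : (Fin d → ℤ) → ℝ}

theorem killedOp_exp_le (hnn : ∀ z, 0 ≤ μ z) (A : Set (Fin d → ℤ)) (a : Fin d → ℝ) :
    killedOp μ A (fun x => ENNReal.ofReal (Real.exp (dotZ a x))) ≤
      phiE μ a • fun x : A => ENNReal.ofReal (Real.exp (dotZ a x)) := by
  intro x
  rw [killedOp_apply, Pi.smul_apply, smul_eq_mul]
  calc ∑' z : A, ENNReal.ofReal (μ (z.1 - x.1)) * ENNReal.ofReal (Real.exp (dotZ a z))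
      ≤ ∑' z, ENNReal.ofReal (μ (z - x.1)) * ENNReal.ofReal (Real.exp (dotZ a z)) :=
        ENNReal.tsum_comp_le_tsum_of_injective Subtype.val_injective
          fun z => ENNReal.ofReal (μ (z - x.1)) * ENNReal.ofReal (Real.exp (dotZ a z))
    _ = ∑' z, ENNReal.ofReal (μ (z - x.1) * Real.exp (dotZ a (z - x.1))) *
          ENNReal.ofReal (Real.exp (dotZ a x)) := by
        refine tsum_congr fun z => ?_
        have := hnn (z - x.1)
        rw [← ENNReal.ofReal_mul (hnn _), ← ENNReal.ofReal_mul (by positivity), mul_assoc,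
          ← Real.exp_add, dotZ_sub, sub_add_cancel]
    _ = phiE μ a * ENNReal.ofReal (Real.exp (dotZ a x)) := by
        rw [ENNReal.tsum_mul_right]
        congr 1
        exact Equiv.tsum_eq (Equiv.subRight x.1)
          fun v => ENNReal.ofReal (μ v * Real.exp (dotZ a v))

theorem pointInd_le_exp (A : Set (Fin d → ℤ)) (a : Fin d → ℝ) (y : A) :
    pointInd y ≤ ENNReal.ofReal (Real.exp (-dotZ a y)) •
      fun x : A => ENNReal.ofReal (Real.exp (dotZ a x)) := by
  intro x
  by_cases h : x = y
  · subst h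
    simp [pointInd, ← ENNReal.ofReal_mul (Real.exp_pos _).le, ← Real.exp_add]
  · simp [pointInd, h]

theorem end_pow_pointInd_le_exp {A : Set (Fin d → ℤ)}
    {L : Module.End ℝ≥0∞ (A → ℝ≥0∞)} {a : Fin d → ℝ} {b : ℝ≥0∞}
    (hL : L (fun x => ENNReal.ofReal (Real.exp (dotZ a x))) ≤
      b • fun x : A => ENNReal.ofReal (Real.exp (dotZ a x))) (n : ℕ) (x y : A) :
    (L ^ n) (pointInd y) x ≤ b ^ n * ENNReal.ofReal (Real.exp (dotZ a x - dotZ a y)) := by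
  have h1 := end_mono (L ^ n) (pointInd_le_exp A a y) x
  rw [map_smul] at h1
  refine h1.trans ?_
  rw [Pi.smul_apply, smul_eq_mul]
  refine (mul_le_mul_right (end_pow_le L hL n x) _).trans (le_of_eq ?_)
  rw [Pi.smul_apply, smul_eq_mul, mul_left_comm, ← ENNReal.ofReal_mul (Real.exp_pos _).le,
    ← Real.exp_add, neg_add_eq_sub]

theorem greenE_ne_top (hnn : ∀ z, 0 ≤ μ z) (A : Set (Fin d → ℤ)) {a : Fin d → ℝ}
    (ha : phiE μ a < 1) (x y : A) : greenE μ A y x ≠ ⊤ := by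
  refine ne_top_of_le_ne_top ?_ (ENNReal.tsum_le_tsum fun n =>
    end_pow_pointInd_le_exp (killedOp_exp_le hnn A a) n x y)
  rw [ENNReal.tsum_mul_right, ENNReal.tsum_geometric]
  refine ENNReal.mul_ne_top ?_ ENNReal.ofReal_ne_top
  rw [ENNReal.inv_ne_top]
  exact (tsub_pos_of_lt ha).ne'

theorem sum_lazyOp_pow_pointInd_le (hnn : ∀ z, 0 ≤ μ z) (A : Set (Fin d → ℤ)) (a : Fin d → ℝ)
    (N : ℕ) (x y : A) :
    ∑ n ∈ Finset.range N, (lazyOp (killedOp μ A) ^ n) (pointInd y) x ≤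
      (2 * (1 + phiE μ a)) ^ N * ENNReal.ofReal (Real.exp (dotZ a x - dotZ a y)) := by
  have hb : (1 : ℝ≥0∞) ≤ 1 + phiE μ a := le_self_add
  have hL : lazyOp (killedOp μ A) (fun x => ENNReal.ofReal (Real.exp (dotZ a x))) ≤
      (1 + phiE μ a) • fun x : A => ENNReal.ofReal (Real.exp (dotZ a x)) :=
    lazyOp_le_smul hb ((killedOp_exp_le hnn A a).trans (fun x => mul_le_mul_left le_add_self _))
  calc _ ≤ ∑ n ∈ Finset.range N,
        (1 + phiE μ a) ^ N * ENNReal.ofReal (Real.exp (dotZ a x - dotZ a y)) := by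
        refine Finset.sum_le_sum fun n hn => (end_pow_pointInd_le_exp hL n x y).trans ?_
        gcongr
        exact (Finset.mem_range.1 hn).le
    _ = N * ((1 + phiE μ a) ^ N * ENNReal.ofReal (Real.exp (dotZ a x - dotZ a y))) := by
        rw [Finset.sum_const, Finset.card_range, nsmul_eq_mul]
    _ ≤ _ := by
        rw [mul_pow, mul_assoc]
        gcongr
        exact_mod_cast Nat.lt_two_pow_self.le

end UpperBounds

/-! ### Harnack inequality -/

section Harnack

open scoped ENNReal

variable {d : ℕ} {μ : (Fin d → ℤ) → ℝ} {Λ : Set (Fin d)}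

theorem exists_killedOp_pow_ge (hirr : Irred μ (posDom Λ)) {u v : Fin d → ℤ}
    (hu : u ∈ posDom Λ) (hv : v ∈ posDom Λ) :
    ∃ (k : ℕ) (c : ℝ≥0∞), c ≠ 0 ∧ ∀ x z : posDom Λ, (∀ i ∈ Λ, u i ≤ x.1 i) →
      z.1 - x.1 = v - u → ∀ f, c * f z ≤ (killedOp μ (posDom Λ) ^ k) f x := by
  obtain ⟨k, p, hp0, hpk, hpA, hpμ⟩ := hirr u hu v hv
  have key : ∀ j ≤ k, ∃ c : ℝ≥0∞, c ≠ 0 ∧ ∀ x z : posDom Λ, (∀ i ∈ Λ, u i ≤ x.1 i) →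
      z.1 - x.1 = p j - u → ∀ f, c * f z ≤ (killedOp μ (posDom Λ) ^ j) f x := by
    intro j
    induction j with
    | zero =>
      refine fun _ => ⟨1, one_ne_zero, fun x z _ hz f => ?_⟩
      have : z = x := by
        rw [hp0, sub_self, sub_eq_zero] at hz
        exact Subtype.ext hz
      simp [this]
    | succ j ih =>
      intro hj
      obtain ⟨c, hc, H⟩ := ih (by omega)
      have hμ := hpμ j (by omega)
      refine ⟨c * ENNReal.ofReal (μ (p (j + 1) - p j)),
        mul_ne_zero hc (ENNReal.ofReal_pos.2 hμ).ne', fun x z hx hz f => ?_⟩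
      let y : posDom Λ := ⟨x.1 + (p j - u), fun i hi => by
        have h1 := hpA j (by omega) i hi
        have h2 := hx i hi
        simp only [Pi.add_apply, Pi.sub_apply]
        omega⟩
      have hzy : z.1 - y.1 = p (j + 1) - p j := by
        have : z.1 = x.1 + (p (j + 1) - u) := by rw [← hz]; abel
        rw [this]
        simp only [y]
        abel
      rw [pow_succ, Module.End.mul_apply, mul_assoc]
      refine le_trans ?_ (H x y hx (by simp [y]) _)
      gcongr
      rw [killedOp_apply, ← hzy]
      exact ENNReal.le_tsum (f := fun z : posDom Λ => ENNReal.ofReal (μ (z.1 - y.1)) * f z) z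
  obtain ⟨c, hc, H⟩ := key k le_rfl
  exact ⟨k, c, hc, by rwa [hpk] at H⟩

theorem exists_ofReal_exp_neg_le {c : ℝ≥0∞} (hc : c ≠ 0) :
    ∃ γ : ℝ, 0 ≤ γ ∧ ENNReal.ofReal (Real.exp (-γ)) ≤ c := by
  by_cases htop : c = ⊤
  · exact ⟨0, le_rfl, by simp [htop]⟩
  · refine ⟨max 0 (-Real.log c.toReal), le_max_left _ _, ?_⟩
    refine ENNReal.ofReal_le_of_le_toReal ?_
    rw [← Real.le_log_iff_exp_le (ENNReal.toReal_pos hc htop)]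
    linarith [le_max_right 0 (-Real.log c.toReal)]

theorem exists_step_harnack (hirr : Irred μ (posDom Λ)) : ∃ γ : ℝ, 0 ≤ γ ∧
    ∀ (i : Fin d) (y x z : posDom Λ), (z.1 - x.1 = Pi.single i 1 ∨ x.1 - z.1 = Pi.single i 1) →
      ENNReal.ofReal (Real.exp (-γ)) * greenE μ (posDom Λ) y z ≤ greenE μ (posDom Λ) y x := by
  have hmove : ∀ (i : Fin d), ∃ γ : ℝ, 0 ≤ γ ∧
      ∀ (y x z : posDom Λ), (z.1 - x.1 = Pi.single i 1 ∨ x.1 - z.1 = Pi.single i 1) →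
      ENNReal.ofReal (Real.exp (-γ)) * greenE μ (posDom Λ) y z ≤ greenE μ (posDom Λ) y x := by
    intro i
    have h1 : (1 : Fin d → ℤ) ∈ posDom Λ := fun j _ => by simp
    have h2 : (1 + Pi.single i 1 : Fin d → ℤ) ∈ posDom Λ := fun j _ => by
      have : (0 : ℤ) ≤ (Pi.single i 1 : Fin d → ℤ) j := by
        rw [Pi.single_apply]; split_ifs <;> simp
      simp only [Pi.add_apply, Pi.one_apply]
      omega
    obtain ⟨k, c, hc, H⟩ := exists_killedOp_pow_ge hirr h1 h2
    obtain ⟨k', c', hc', H'⟩ := exists_killedOp_pow_ge hirr h2 h1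
    obtain ⟨γ, hγ, hγc⟩ := exists_ofReal_exp_neg_le hc
    obtain ⟨γ', hγ', hγc'⟩ := exists_ofReal_exp_neg_le hc'
    refine ⟨γ + γ', by positivity, fun y x z h => ?_⟩
    rcases h with h | h
    · refine le_trans ?_ (killedOp_pow_greenE_le μ _ k y x)
      refine le_trans ?_ (H x z (fun j hj => x.2 j hj) (by rw [h]; abel) _)
      gcongr
      refine le_trans (ENNReal.ofReal_le_ofReal (Real.exp_le_exp.2 ?_)) hγc
      linarith
    · refine le_trans ?_ (killedOp_pow_greenE_le μ _ k' y x)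
      refine le_trans ?_ (H' x z (fun j hj => ?_) (by rw [← neg_sub, h]; abel) _)
      · gcongr
        refine le_trans (ENNReal.ofReal_le_ofReal (Real.exp_le_exp.2 ?_)) hγc'
        linarith
      · have h3 := congrFun h j
        have h4 := z.2 j hj
        simp only [Pi.sub_apply, Pi.add_apply, Pi.one_apply] at h3 ⊢
        omega
  choose γ hγ H using hmove
  refine ⟨∑ i, γ i, Finset.sum_nonneg fun i _ => hγ i, fun i y x z h => ?_⟩
  refine le_trans ?_ (H i y x z h)
  gcongr
  exact Finset.single_le_sum (fun i _ => hγ i) (Finset.mem_univ i)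

theorem exists_neighbor_toward (x z : posDom Λ) (h : x ≠ z) :
    ∃ (i : Fin d) (x' : posDom Λ),
      (x'.1 - x.1 = Pi.single i 1 ∨ x.1 - x'.1 = Pi.single i 1) ∧
      znorm (x'.1 - z.1) = znorm (x.1 - z.1) - 1 := by
  obtain ⟨i, hi⟩ := Function.ne_iff.1 fun h' => h (Subtype.ext h')
  have hnorm : ∀ x' : Fin d → ℤ, (∀ j ≠ i, x' j = x.1 j) →
      |x' i - z.1 i| = |x.1 i - z.1 i| - 1 → znorm (x' - z.1) = znorm (x.1 - z.1) - 1 := by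
    intro x' hx' hxi
    rw [znorm, znorm, ← Finset.add_sum_erase _ _ (Finset.mem_univ i),
      ← Finset.add_sum_erase (Finset.univ) (fun j => |((x.1 - z.1) j : ℝ)|) (Finset.mem_univ i)]
    have h1 : |((x' - z.1) i : ℝ)| = |((x.1 - z.1) i : ℝ)| - 1 := by
      simp only [Pi.sub_apply]
      exact_mod_cast hxi
    rw [h1, Finset.sum_congr rfl fun j hj => by
      rw [Pi.sub_apply, hx' j (Finset.ne_of_mem_erase hj), ← Pi.sub_apply]]
    ring
  rcases lt_or_gt_of_ne hi with hlt | hgt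
  · refine ⟨i, ⟨x.1 + Pi.single i 1, fun j hj => ?_⟩, Or.inl (by simp), ?_⟩
    · have := x.2 j hj
      have h0 : (0 : ℤ) ≤ (Pi.single i 1 : Fin d → ℤ) j := by
        rw [Pi.single_apply]; split_ifs <;> simp
      simp only [Pi.add_apply]
      omega
    · refine hnorm _ (fun j hj => by simp [hj]) ?_
      simp only [Pi.add_apply, Pi.single_eq_same]
      rw [abs_of_nonpos (by omega), abs_of_neg (by omega)]
      omega
  · refine ⟨i, ⟨x.1 - Pi.single i 1, fun j hj => ?_⟩, Or.inr (by simp), ?_⟩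
    · have h1 := x.2 j hj
      by_cases hji : j = i
      · subst hji
        have h2 := z.2 j hj
        simp only [Pi.sub_apply, Pi.single_eq_same]
        omega
      · simpa [hji] using h1
    · refine hnorm _ (fun j hj => by simp [hj]) ?_
      simp only [Pi.sub_apply, Pi.single_eq_same]
      rw [abs_of_nonneg (by omega), abs_of_pos (by omega)]
      omega

theorem exists_harnack (hirr : Irred μ (posDom Λ)) : ∃ γ : ℝ, 0 ≤ γ ∧ ∀ y x z : posDom Λ,
    ENNReal.ofReal (Real.exp (-(γ * znorm (x.1 - z.1)))) * greenE μ (posDom Λ) y z ≤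
      greenE μ (posDom Λ) y x := by
  obtain ⟨γ, hγ, H⟩ := exists_step_harnack hirr
  refine ⟨γ, hγ, fun y x z => ?_⟩
  have key : ∀ (N : ℕ) (x : posDom Λ), znorm (x.1 - z.1) = N →
      ENNReal.ofReal (Real.exp (-(γ * znorm (x.1 - z.1)))) * greenE μ (posDom Λ) y z ≤
        greenE μ (posDom Λ) y x := by
    intro N
    induction N with
    | zero =>
      intro x hx
      have : x = z := by
        by_contra h
        obtain ⟨i, x', -, h'⟩ := exists_neighbor_toward x z h
        have := znorm_nonneg (x'.1 - z.1)
        rw [h', hx] at this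
        norm_num at this
      rw [hx, this]
      simp
    | succ N ih =>
      intro x hx
      have hne : x ≠ z := by
        rintro rfl
        simp only [sub_self, znorm, Pi.zero_apply, Int.cast_zero, abs_zero,
          Finset.sum_const_zero] at hx
        norm_cast at hx
      obtain ⟨i, x', hstep, h'⟩ := exists_neighbor_toward x z hne
      have h1 := ih x' (by rw [h', hx]; push_cast; ring)
      calc ENNReal.ofReal (Real.exp (-(γ * znorm (x.1 - z.1)))) * greenE μ (posDom Λ) y z
          = ENNReal.ofReal (Real.exp (-γ)) *
            (ENNReal.ofReal (Real.exp (-(γ * znorm (x'.1 - z.1)))) *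
              greenE μ (posDom Λ) y z) := by
            rw [← mul_assoc, ← ENNReal.ofReal_mul (Real.exp_pos _).le, ← Real.exp_add, h']
            ring_nf
        _ ≤ ENNReal.ofReal (Real.exp (-γ)) * greenE μ (posDom Λ) y x' := by gcongr
        _ ≤ _ := H i y x x' hstep
  refine key (∑ i, (x.1 i - z.1 i).natAbs) x ?_
  rw [znorm]
  push_cast
  exact Finset.sum_congr rfl fun i _ => by simp

end Harnack

/-! ### Lower bound for the mass carried along the drift -/

section LowerBounds

open scoped ENNReal

variable {d : ℕ} {μ : (Fin d → ℤ) → ℝ}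

theorem hasSum_mul_sq_dist (hnn : ∀ z, 0 ≤ μ z) (hsum : HasSum μ 1) {r : ℝ} (hr : 0 < r)
    (hsr : Summable fun z => μ z * Real.exp (r * znorm z)) (c : Fin d → ℝ) :
    HasSum (fun v => μ v * ∑ i, (v i + c i) ^ 2)
      (∑ i, ((∑' z, μ z * (z i : ℝ) ^ 2) + 2 * c i * Mvec μ i + c i ^ 2)) := by
  have h1 := hasSum_sum fun i (_ : i ∈ Finset.univ) =>
    ((summable_mul_sq hnn hr hsr i).hasSum.add
      ((hasSum_Mvec hnn hsum hr hsr i).mul_left (2 * c i))).add (hsum.mul_left (c i ^ 2))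
  simp only [mul_one] at h1
  refine h1.congr_fun fun v => ?_
  rw [Finset.mul_sum]
  exact Finset.sum_congr rfl fun i _ => by ring

/-- A Chebyshev-type bound for the walk killed outside `posDom (LambdaM μ)`: it is near `q` at
time `s` with high probability as soon as `x + s M` is close to `q` and `q` is far from the
boundary. -/
theorem one_le_killedOp_pow_add (hnn : ∀ z, 0 ≤ μ z) (hsum : HasSum μ 1) {r₀ : ℝ}
    (hr₀ : 0 < r₀) (hsr : Summable fun z => μ z * Real.exp (r₀ * znorm z)) {r : ℝ} (hr : 0 < r)
    {q : Fin d → ℝ} (hq : ∀ i ∈ LambdaM μ, r ≤ q i) :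
    ∀ (s : ℕ) (x : posDom (LambdaM μ)), 1 ≤ (killedOp μ (posDom (LambdaM μ)) ^ s)
        (fun z => if ∑ i, ((z.1 i : ℝ) - q i) ^ 2 ≤ r ^ 2 then 1 else 0) x +
      ENNReal.ofReal ((∑ i, ((x.1 i : ℝ) + s * Mvec μ i - q i) ^ 2 +
        s * ∑ i, ∑' z, μ z * (z i : ℝ) ^ 2) / r ^ 2) := by
  set A := posDom (LambdaM μ)
  set S := ∑ i, ∑' z, μ z * (z i : ℝ) ^ 2 with hS
  have hS0 : 0 ≤ S := Finset.sum_nonneg fun i _ =>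
    tsum_nonneg fun z => mul_nonneg (hnn z) (sq_nonneg _)
  set f : A → ℝ≥0∞ := fun z => if ∑ i, ((z.1 i : ℝ) - q i) ^ 2 ≤ r ^ 2 then 1 else 0 with hf
  set W : ℕ → (Fin d → ℤ) → ℝ := fun s x =>
    (∑ i, ((x i : ℝ) + s * Mvec μ i - q i) ^ 2 + s * S) / r ^ 2 with hW
  have hW0 : ∀ s x, 0 ≤ W s x := fun s x => by
    refine div_nonneg (add_nonneg (Finset.sum_nonneg fun i _ => sq_nonneg _) ?_) (sq_nonneg _)
    positivity
  intro s x
  change 1 ≤ (killedOp μ A ^ s) f x + ENNReal.ofReal (W s x.1)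
  induction s generalizing x with
  | zero =>
    by_cases h : ∑ i, ((x.1 i : ℝ) - q i) ^ 2 ≤ r ^ 2
    · simp [hf, h]
    · refine le_trans ?_ le_add_self
      rw [ENNReal.one_le_ofReal, hW, le_div_iff₀ (by positivity)]
      simpa using (not_le.1 h).le
  | succ s ih =>
    set F : (Fin d → ℤ) → ℝ≥0∞ :=
      fun z => if h : z ∈ A then (killedOp μ A ^ s) f ⟨z, h⟩ else 0 with hF
    have hFW : ∀ z, 1 ≤ F z + ENNReal.ofReal (W s z) := by
      intro z
      by_cases hz : z ∈ A
      · simpa [hF, hz] using ih ⟨z, hz⟩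
      · refine le_trans ?_ le_add_self
        obtain ⟨i, hi, hzi⟩ : ∃ i ∈ LambdaM μ, z i ≤ 0 := by
          simpa [A, posDom] using hz
        have hM : Mvec μ i = 0 := hi
        have hzi' : (z i : ℝ) ≤ 0 := by exact_mod_cast hzi
        rw [ENNReal.one_le_ofReal, hW, le_div_iff₀ (by positivity), one_mul]
        have h1 := Finset.single_le_sum (f := fun i => ((z i : ℝ) + s * Mvec μ i - q i) ^ 2)
          (fun i _ => sq_nonneg _) (Finset.mem_univ i)
        simp only [hM, mul_zero, add_zero] at h1
        have h2 : r ^ 2 ≤ ((z i : ℝ) - q i) ^ 2 := by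
          have := hq i hi
          nlinarith
        have h3 : 0 ≤ (s : ℝ) * S := by positivity
        linarith
    have hFsum : ∑' z, ENNReal.ofReal (μ (z - x.1)) * F z = (killedOp μ A ^ (s + 1)) f x := by
      rw [pow_succ', Module.End.mul_apply, killedOp_apply,
        ← tsum_subtype_eq_of_support_subset (s := A) fun z hz => ?_]
      · exact tsum_congr fun z => by simp [hF]
      · by_contra hzA
        exact hz (by simp [hF, hzA])
    have hWsum : ∑' z, ENNReal.ofReal (μ (z - x.1)) * ENNReal.ofReal (W s z) ≤
        ENNReal.ofReal (W (s + 1) x.1) := by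
      have h1 : ∑' z, ENNReal.ofReal (μ (z - x.1)) * ENNReal.ofReal (W s z) =
          ∑' v, ENNReal.ofReal (μ v * W s (v + x.1)) := by
        rw [← Equiv.tsum_eq (Equiv.addRight x.1)]
        refine tsum_congr fun v => ?_
        rw [ENNReal.ofReal_mul (hnn v)]
        simp
      have h2 := ((hasSum_mul_sq_dist hnn hsum hr₀ hsr
        (fun i => (x.1 i : ℝ) + s * Mvec μ i - q i)).add
          (hsum.mul_right (s * S))).div_const (r ^ 2)
      have h3 : ∀ v, μ v * W s (v + x.1) =
          (μ v * ∑ i, ((v i : ℝ) + ((x.1 i : ℝ) + s * Mvec μ i - q i)) ^ 2 +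
            μ v * (s * S)) / r ^ 2 := by
        intro v
        simp only [hW]
        rw [← mul_add, mul_div_assoc]
        congr 4
        ext i
        push_cast [Pi.add_apply]
        ring
      simp_rw [← h3] at h2
      rw [h1, ← ENNReal.ofReal_tsum_of_nonneg (fun v => mul_nonneg (hnn v) (hW0 _ _))
        h2.summable, h2.tsum_eq]
      refine ENNReal.ofReal_le_ofReal ?_
      simp only [hW]
      refine div_le_div_of_nonneg_right ?_ (sq_nonneg r)
      rw [Finset.sum_add_distrib, Finset.sum_add_distrib, ← hS, one_mul]
      have h4 : ∑ i, ((x.1 i : ℝ) + ((s + 1 : ℕ) : ℝ) * Mvec μ i - q i) ^ 2 =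
          ∑ i, 2 * ((x.1 i : ℝ) + s * Mvec μ i - q i) * Mvec μ i +
            ∑ i, ((x.1 i : ℝ) + s * Mvec μ i - q i) ^ 2 + ∑ i, Mvec μ i ^ 2 := by
        rw [← Finset.sum_add_distrib, ← Finset.sum_add_distrib]
        refine Finset.sum_congr rfl fun i _ => ?_
        push_cast
        ring
      have h5 : 0 ≤ ∑ i, Mvec μ i ^ 2 := Finset.sum_nonneg fun i _ => sq_nonneg _
      rw [h4]
      push_cast
      linarith
    calc (1 : ℝ≥0∞) = ∑' z, ENNReal.ofReal (μ (z - x.1)) := (tsum_ofReal_sub hnn hsum _).symm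
      _ ≤ ∑' z, (ENNReal.ofReal (μ (z - x.1)) * F z +
            ENNReal.ofReal (μ (z - x.1)) * ENNReal.ofReal (W s z)) := by
          refine ENNReal.tsum_le_tsum fun z => ?_
          rw [← mul_add]
          exact le_mul_of_one_le_right' (hFW z)
      _ ≤ _ := by
          rw [ENNReal.tsum_add, hFsum]
          gcongr

end LowerBounds

/-! ### Subexponential lower bound for the Green function -/

section GreenLowerBound

open scoped ENNReal

variable {d : ℕ} {μ : (Fin d → ℤ) → ℝ}

theorem znorm_le_of_abs_le {z : Fin d → ℤ} {r : ℝ} (h : ∀ i, |(z i : ℝ)| ≤ r) :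
    znorm z ≤ d * r := by
  rw [znorm]
  simpa using Finset.sum_le_card_nsmul Finset.univ (fun i => |(z i : ℝ)|) r fun i _ => h i

theorem exp_le_greenE (hnn : ∀ z, 0 ≤ μ z) (hsum : HasSum μ 1) {r₀ : ℝ}
    (hr₀ : 0 < r₀) (hsr : Summable fun z => μ z * Real.exp (r₀ * znorm z)) (hA3 : A3 μ)
    {γ : ℝ} (hγ : 0 ≤ γ) (hH : ∀ y x z : posDom (LambdaM μ),
      ENNReal.ofReal (Real.exp (-(γ * znorm (x.1 - z.1)))) * greenE μ (posDom (LambdaM μ)) y z ≤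
        greenE μ (posDom (LambdaM μ)) y x)
    {κ L : ℝ} (hκ : 0 < κ) (hL : 0 < L) (x y : posDom (LambdaM μ)) (hx : znorm x.1 ≤ κ * L)
    (hκL : 1 + rnorm (Mvec μ) ≤ κ * L)
    (hy : ∀ i, |L * (Mvec μ i / rnorm (Mvec μ)) - y.1 i| ≤ κ * L)
    (hS : L / rnorm (Mvec μ) * ∑ i, ∑' z, μ z * (z i : ℝ) ^ 2 ≤ (κ * L) ^ 2 / 2) :
    ENNReal.ofReal (Real.exp (-(γ * ((1 + 6 * d) * (κ * L)))) / 2) ≤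
      greenE μ (posDom (LambdaM μ)) y x := by
  set M := Mvec μ with hM
  set S := ∑ i, ∑' z, μ z * (z i : ℝ) ^ 2 with hSdef
  set R := κ * L with hR
  have hR0 : 0 < R := mul_pos hκ hL
  have hm : 0 < rnorm M := rnorm_pos hA3
  have hS0 : 0 ≤ S := Finset.sum_nonneg fun i _ =>
    tsum_nonneg fun z => mul_nonneg (hnn z) (sq_nonneg _)
  let x₀ : posDom (LambdaM μ) := ⟨fun i => if i ∈ LambdaM μ then ⌈R⌉ else 0, fun i hi => by
    simpa [hi] using hR0⟩
  have hx₀0 : ∀ i, 0 ≤ (x₀.1 i : ℝ) ∧ (x₀.1 i : ℝ) ≤ R + 1 := by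
    intro i
    by_cases hi : i ∈ LambdaM μ
    · simp only [x₀, hi, if_true]
      exact ⟨by exact_mod_cast (Int.ceil_pos.2 hR0).le, (Int.ceil_lt_add_one R).le⟩
    · simp only [x₀, hi, if_false, Int.cast_zero, le_refl, true_and]
      positivity
  set t := ⌊L / rnorm M⌋₊ with ht
  have ht1 : (t : ℝ) ≤ L / rnorm M := Nat.floor_le (by positivity)
  have ht2 : L / rnorm M < t + 1 := Nat.lt_floor_add_one _
  set q : Fin d → ℝ := fun i => x₀.1 i + t * M i with hq
  have hqR : ∀ i ∈ LambdaM μ, R ≤ q i := by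
    intro i hi
    have hMi : M i = 0 := hi
    simp only [hq, hMi, mul_zero, add_zero, x₀, hi, if_true]
    exact Int.le_ceil R
  have hmass := one_le_killedOp_pow_add hnn hsum hr₀ hsr hR0 hqR t x₀
  have hW : (∑ i, ((x₀.1 i : ℝ) + t * Mvec μ i - q i) ^ 2 + t * S) / R ^ 2 ≤ 1 / 2 := by
    have h0 : ∑ i, ((x₀.1 i : ℝ) + t * Mvec μ i - q i) ^ 2 = 0 :=
      Finset.sum_eq_zero fun i _ => by simp [hq, hM]
    rw [h0, zero_add, div_le_iff₀ (by positivity)]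
    have := mul_le_mul_of_nonneg_right ht1 hS0
    linarith
  have hhalf : ENNReal.ofReal (1 / 2) ≤ (killedOp μ (posDom (LambdaM μ)) ^ t)
      (fun z => if ∑ i, ((z.1 i : ℝ) - q i) ^ 2 ≤ R ^ 2 then 1 else 0) x₀ := by
    have h1 : (1 : ℝ≥0∞) = ENNReal.ofReal (1 / 2) + ENNReal.ofReal (1 / 2) := by
      rw [← ENNReal.ofReal_add (by norm_num) (by norm_num)]
      norm_num
    have h2 := hmass.trans (add_le_add_right (ENNReal.ofReal_le_ofReal hW) _)
    exact (ENNReal.add_le_add_iff_right ENNReal.ofReal_ne_top).1 (h1.symm.trans_le h2)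
  have hball : ENNReal.ofReal (Real.exp (-(γ * (4 * d * R)))) •
      (fun z : posDom (LambdaM μ) =>
        if ∑ i, ((z.1 i : ℝ) - q i) ^ 2 ≤ R ^ 2 then (1 : ℝ≥0∞) else 0) ≤
        greenE μ (posDom (LambdaM μ)) y := by
    intro z
    rw [Pi.smul_apply, smul_eq_mul]
    split_ifs with hz
    · rw [mul_one]
      refine le_trans ?_ (hH y z y)
      refine le_trans ?_ (mul_le_mul_right (one_le_greenE_self μ _ y) _)
      rw [mul_one]
      refine ENNReal.ofReal_le_ofReal (Real.exp_le_exp.2 (neg_le_neg ?_))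
      refine mul_le_mul_of_nonneg_left ?_ hγ
      have : znorm (z.1 - y.1) ≤ d * (4 * R) := by
        refine znorm_le_of_abs_le fun i => ?_
        have h1 : |(z.1 i : ℝ) - q i| ≤ R := by
          refine abs_le_of_sq_le_sq ?_ hR0.le
          exact (Finset.single_le_sum (f := fun i => ((z.1 i : ℝ) - q i) ^ 2)
            (fun _ _ => sq_nonneg _) (Finset.mem_univ i)).trans hz
        have h2 : |t * M i - L * (M i / rnorm M)| ≤ rnorm M := by
          have : t * M i - L * (M i / rnorm M) = (t - L / rnorm M) * M i := by ring
          rw [this, abs_mul]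
          refine le_trans ?_ (abs_le_rnorm M i)
          refine mul_le_of_le_one_left (abs_nonneg _) ?_
          rw [abs_le]
          constructor <;> linarith
        have h3 := hx₀0 i
        have h4 := hy i
        simp only [hq] at h1
        rw [abs_le] at h1 h2 h4 ⊢
        push_cast [Pi.sub_apply]
        constructor <;> linarith [h1.1, h1.2, h2.1, h2.2, h4.1, h4.2, h3.1, h3.2]
      linarith
    · simp
  have hx₀x : znorm (x.1 - x₀.1) ≤ (1 + 2 * d) * R := by
    have h1 : znorm (x.1 - x₀.1) ≤ znorm x.1 + znorm (-x₀.1) := by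
      rw [sub_eq_add_neg]
      exact znorm_add_le _ _
    have h2 : znorm (-x₀.1) ≤ d * (2 * R) := by
      refine znorm_le_of_abs_le fun i => ?_
      rw [Pi.neg_apply, Int.cast_neg, abs_neg, abs_of_nonneg (hx₀0 i).1]
      linarith [(hx₀0 i).2]
    linarith
  have h1 : ENNReal.ofReal (Real.exp (-(γ * (4 * d * R)))) * ENNReal.ofReal (1 / 2) ≤
      greenE μ (posDom (LambdaM μ)) y x₀ := by
    refine le_trans ?_ (killedOp_pow_greenE_le μ _ t y x₀)
    refine le_trans ?_ (end_mono (killedOp μ (posDom (LambdaM μ)) ^ t) hball x₀)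
    rw [map_smul, Pi.smul_apply, smul_eq_mul]
    gcongr
  refine le_trans ?_ (hH y x x₀)
  refine le_trans ?_ (mul_le_mul_right h1 _)
  rw [← ENNReal.ofReal_mul (Real.exp_pos _).le, ← ENNReal.ofReal_mul (Real.exp_pos _).le,
    ← mul_assoc (Real.exp _), ← Real.exp_add, mul_one_div]
  refine ENNReal.ofReal_le_ofReal (div_le_div_of_nonneg_right (Real.exp_le_exp.2 ?_) two_pos.le)
  nlinarith [mul_le_mul_of_nonneg_left hx₀x hγ]

theorem eventually_abs_sub_le {xs : ℕ → (Fin d → ℤ)} {v : Fin d → ℝ}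
    (hnorm : Tendsto (fun n => znorm (xs n)) atTop atTop)
    (hdir : Tendsto (fun n i => (xs n i : ℝ) / znorm (xs n)) atTop (𝓝 v))
    {κ : ℝ} (hκ : 0 < κ) :
    ∀ᶠ n in atTop, ∀ i, |znorm (xs n) * v i - xs n i| ≤ κ * znorm (xs n) := by
  rw [Filter.eventually_all]
  intro i
  have h1 := (Metric.tendsto_nhds.1 (tendsto_pi_nhds.1 hdir i)) κ hκ
  filter_upwards [h1, hnorm.eventually_gt_atTop 0] with n h1 h2
  rw [Real.dist_eq] at h1
  have h3 : znorm (xs n) * v i - xs n i =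
      -(((xs n i : ℝ) / znorm (xs n) - v i) * znorm (xs n)) := by
    field_simp
    ring
  rw [h3, abs_neg, abs_mul, abs_of_pos h2]
  gcongr

theorem eventually_exp_le_greenE (hnn : ∀ z, 0 ≤ μ z) (hsum : HasSum μ 1) (hA2 : A2 μ)
    (hA3 : A3 μ) (hirr : Irred μ (posDom (LambdaM μ)))
    {xs : ℕ → (Fin d → ℤ)} (hxs : ∀ n, xs n ∈ posDom (LambdaM μ))
    (hnorm : Tendsto (fun n => znorm (xs n)) atTop atTop)
    (hdir : Tendsto (fun n i => (xs n i : ℝ) / znorm (xs n)) atTop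
      (𝓝 (fun i => Mvec μ i / rnorm (Mvec μ)))) {η : ℝ} (hη : 0 < η) :
    ∃ δ > 0, ∀ᶠ n in atTop, ∀ x : posDom (LambdaM μ), znorm x.1 < δ * znorm (xs n) →
      ENNReal.ofReal (Real.exp (-(η * znorm (xs n)))) ≤
        greenE μ (posDom (LambdaM μ)) ⟨xs n, hxs n⟩ x := by
  obtain ⟨r₀, hr₀, hsr⟩ := exists_summable_exp hnn hsum hA2
  obtain ⟨γ, hγ, hH⟩ := exists_harnack hirr
  set S := ∑ i, ∑' z, μ z * (z i : ℝ) ^ 2 with hS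
  have hm : 0 < rnorm (Mvec μ) := rnorm_pos hA3
  set κ := η / (2 * (γ + 1) * (1 + 6 * d)) with hκdef
  have hκ : 0 < κ := by positivity
  have hκη : γ * ((1 + 6 * d) * κ) ≤ η / 2 := by
    have : (γ + 1) * ((1 + 6 * d) * κ) = η / 2 := by
      rw [hκdef]
      field_simp
    have h0 : 0 ≤ (1 + 6 * (d : ℝ)) * κ := by positivity
    linarith
  refine ⟨κ, hκ, ?_⟩
  filter_upwards [eventually_abs_sub_le hnorm hdir hκ, hnorm.eventually_gt_atTop 0,
    (hnorm.const_mul_atTop hκ).eventually_ge_atTop (1 + rnorm (Mvec μ)),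
    (hnorm.const_mul_atTop hη).eventually_ge_atTop 2,
    (hnorm.const_mul_atTop (show 0 < κ ^ 2 / 2 by positivity)).eventually_ge_atTop
      (S / rnorm (Mvec μ))] with n h1 h2 h3 h4 h5 x hx
  refine le_trans ?_ (exp_le_greenE hnn hsum hr₀ hsr hA3 hγ hH hκ h2 x ⟨xs n, hxs n⟩ hx.le h3 h1
    ?_)
  · refine ENNReal.ofReal_le_ofReal ?_
    set L := znorm (xs n)
    have h6 : Real.exp (-(η * L)) = Real.exp (-(η * L / 2)) * Real.exp (-(η * L / 2)) := by
      rw [← Real.exp_add]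
      ring_nf
    have h7 : Real.exp (-(η * L / 2)) ≤ 1 / 2 := by
      rw [Real.exp_neg, one_div]
      exact inv_anti₀ two_pos (by linarith [Real.add_one_le_exp (η * L / 2)])
    have h8 : Real.exp (-(η * L / 2)) ≤ Real.exp (-(γ * ((1 + 6 * d) * (κ * L)))) := by
      refine Real.exp_le_exp.2 (neg_le_neg ?_)
      have := mul_le_mul_of_nonneg_right hκη h2.le
      linarith
    rw [h6, div_eq_mul_one_div (Real.exp _)]
    exact mul_le_mul h8 h7 (Real.exp_pos _).le (Real.exp_pos _).le
  · have := mul_le_mul_of_nonneg_left h5 h2.le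
    calc znorm (xs n) / rnorm (Mvec μ) * S = znorm (xs n) * (S / rnorm (Mvec μ)) := by ring
      _ ≤ _ := this
      _ = _ := by ring

end GreenLowerBound

/-! ### Comparison of the Green function at shifted starting points -/

section Shift

open scoped ENNReal

theorem tsum_pow_div_ne_top {ρ : ℝ≥0∞} (hρ : ρ < 1) {k : ℕ} (hk : k ≠ 0) :
    ∑' n : ℕ, ρ ^ (n / k) ≠ ⊤ := by
  have : NeZero k := ⟨hk⟩
  have h1 : ∑' n : ℕ, ρ ^ (n / k) = ∑' p : ℕ × Fin k, ρ ^ p.1 :=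
    Equiv.tsum_eq (Nat.divModEquiv k) fun p : ℕ × Fin k => ρ ^ p.1
  rw [h1, ENNReal.tsum_prod (f := fun j (_ : Fin k) => ρ ^ j), ENNReal.tsum_comm]
  simp only [ENNReal.tsum_geometric, tsum_fintype, Finset.sum_const, nsmul_eq_mul]
  exact ENNReal.mul_ne_top (ENNReal.natCast_ne_top _)
    (ENNReal.inv_ne_top.2 (tsub_pos_of_lt hρ).ne')

theorem exists_tsum_lazyOp_pow_comp_le {X : Type*} {p : X → X → ℝ≥0∞} (τ : Equiv.Perm X)
    (hp : ∀ x, ∑' z, p x z ≤ 1) (hτ : ∀ x z, p (τ x) (τ z) = p x z) {k : ℕ} (hk0 : k ≠ 0)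
    {c : ℝ≥0∞} (hc : c ≠ 0) (hk : ∀ f x, c * f (τ x) ≤ (kernOp p ^ k) f x) {σ : ℝ}
    (hσ : 0 < σ) :
    ∃ C ρ : ℝ≥0∞, C ≠ ⊤ ∧ ρ < 1 ∧ ∀ (N : ℕ) (f : X → ℝ≥0∞) (x : X), f ≤ 1 →
      ∑' n, (lazyOp (kernOp p) ^ n) f (τ x) ≤
        ∑ n ∈ Finset.range (k * N), (lazyOp (kernOp p) ^ n) f (τ x) +
          (ENNReal.ofReal (1 + σ) * ∑' n, (lazyOp (kernOp p) ^ n) f x + C * ρ ^ N) := by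
  obtain ⟨C, ρ, hC, hρ, H⟩ := exists_lazyOp_pow_comp_le τ hp hτ hc hk hσ
  refine ⟨C * ∑' n : ℕ, ρ ^ (n / k), ρ, ENNReal.mul_ne_top hC (tsum_pow_div_ne_top hρ hk0), hρ,
    fun N f x hf => ?_⟩
  set Q := lazyOp (kernOp p)
  have hQ1 : Q 1 ≤ (1 : ℝ≥0∞) • 1 :=
    lazyOp_le_smul le_rfl (kernOp_le_smul_one hp)
  have hstep : ∀ n, (Q ^ n) f (τ x) ≤
      ENNReal.ofReal (1 + σ) * (Q ^ n) f x + C * ρ ^ (n / k) := by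
    intro n
    have h1 : (Q ^ n) f = (Q ^ (k * (n / k))) ((Q ^ (n % k)) f) := by
      rw [← Module.End.mul_apply, ← pow_add, Nat.div_add_mod]
    rw [h1]
    refine H _ _ _ ?_
    simpa using (end_mono (Q ^ (n % k)) hf).trans (end_pow_le Q hQ1 (n % k))
  rw [← ENNReal.summable.sum_add_tsum_nat_add' (f := fun n => (Q ^ n) f (τ x)) (k := k * N)]
  gcongr
  calc ∑' n, (Q ^ (n + k * N)) f (τ x)
      ≤ ∑' n, (ENNReal.ofReal (1 + σ) * (Q ^ (n + k * N)) f x + C * (ρ ^ (n / k) * ρ ^ N)) := by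
        refine ENNReal.tsum_le_tsum fun n => (hstep _).trans (le_of_eq ?_)
        rw [Nat.add_mul_div_left _ _ (Nat.pos_of_ne_zero hk0), pow_add ρ]
    _ = ENNReal.ofReal (1 + σ) * ∑' n, (Q ^ (n + k * N)) f x +
          C * (∑' n : ℕ, ρ ^ (n / k)) * ρ ^ N := by
        rw [ENNReal.tsum_add, ENNReal.tsum_mul_left, ENNReal.tsum_mul_left,
          ENNReal.tsum_mul_right, mul_assoc]
    _ ≤ _ := by
        refine add_le_add_left (mul_le_mul_right ?_ _) _
        exact ENNReal.tsum_comp_le_tsum_of_injective (add_left_injective (k * N))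
          fun n => (Q ^ n) f x

variable {d : ℕ} {μ : (Fin d → ℤ) → ℝ}

theorem exists_greenE_shift_le (hnn : ∀ z, 0 ≤ μ z) (hsum : HasSum μ 1) {Λ : Set (Fin d)}
    (hirr : Irred μ (posDom Λ)) {w : Fin d → ℤ} (hw : ∀ i ∈ Λ, w i = 0) {σ : ℝ} (hσ : 0 < σ) :
    ∃ (k : ℕ) (C ρ : ℝ≥0∞), C ≠ ⊤ ∧ ρ < 1 ∧ ∀ (a : Fin d → ℝ) (N : ℕ) (y x x' : posDom Λ),
      x'.1 = x.1 + w → greenE μ (posDom Λ) y x' ≤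
        (2 * (1 + phiE μ a)) ^ (k * N) * ENNReal.ofReal (Real.exp (dotZ a x' - dotZ a y)) +
          (ENNReal.ofReal (1 + σ) * greenE μ (posDom Λ) y x + C * ρ ^ N) := by
  by_cases hw0 : w = 0
  · refine ⟨0, 0, 0, by simp, by simp, fun a N y x x' h => ?_⟩
    have : x' = x := Subtype.ext (by rw [h, hw0, add_zero])
    rw [this]
    refine le_trans ?_ le_add_self
    refine le_trans ?_ le_self_add
    refine le_mul_of_one_le_left' ?_
    rw [ENNReal.one_le_ofReal]
    linarith
  have hmem : ∀ x : Fin d → ℤ, x ∈ posDom Λ ↔ x + w ∈ posDom Λ := fun x => by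
    refine forall₂_congr fun i hi => ?_
    rw [Pi.add_apply, hw i hi, add_zero]
  let τ : Equiv.Perm (posDom Λ) := (Equiv.addRight w).subtypeEquiv hmem
  have hτ : ∀ x, (τ x).1 = x.1 + w := fun x => rfl
  have h1 : (1 : Fin d → ℤ) ∈ posDom Λ := fun i _ => one_pos
  obtain ⟨k, c, hc, hk⟩ := exists_killedOp_pow_ge hirr h1 ((hmem 1).1 h1)
  have hkτ : ∀ f x, c * f (τ x) ≤ (killedOp μ (posDom Λ) ^ k) f x := fun f x =>
    hk x (τ x) (fun i hi => x.2 i hi) (by rw [hτ]; abel) f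
  have hk0 : k ≠ 0 := by
    rintro rfl
    have h2 := hkτ (pointInd (τ ⟨1, h1⟩)) ⟨1, h1⟩
    have h3 : (⟨1, h1⟩ : posDom Λ) ≠ τ ⟨1, h1⟩ := fun h => hw0 (by
      have := congrArg Subtype.val h
      rwa [hτ, left_eq_add] at this)
    simp [pointInd, h3, hc] at h2
  obtain ⟨C, ρ, hC, hρ, H⟩ := exists_tsum_lazyOp_pow_comp_le τ
    (tsum_killed_le_one hnn hsum (posDom Λ))
    (fun x z => by rw [hτ, hτ, add_sub_add_right_eq_sub]) hk0 hc hkτ hσ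
  refine ⟨k, C, ρ, hC, hρ, fun a N y x x' h => ?_⟩
  obtain rfl : x' = τ x := Subtype.ext h
  have h2 := H N (pointInd y) x (pointInd_le_one y)
  have h3 := sum_lazyOp_pow_pointInd_le hnn (posDom Λ) a (k * N) (τ x) y
  change ∑' n, (lazyOp (killedOp μ (posDom Λ)) ^ n) (pointInd y) (τ x) ≤
    ∑ n ∈ Finset.range (k * N), (lazyOp (killedOp μ (posDom Λ)) ^ n) (pointInd y) (τ x) +
      (ENNReal.ofReal (1 + σ) * ∑' n, (lazyOp (killedOp μ (posDom Λ)) ^ n) (pointInd y) x +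
        C * ρ ^ N) at h2
  rw [tsum_lazyOp_pow, tsum_lazyOp_pow] at h2
  rw [← ENNReal.mul_le_mul_iff_right two_ne_zero ENNReal.ofNat_ne_top]
  refine h2.trans ((add_le_add_left h3 _).trans ?_)
  rw [mul_add 2 (_ ^ _ * _), mul_add 2 (_ * _), mul_left_comm 2 (ENNReal.ofReal (1 + σ))]
  exact add_le_add (le_mul_of_one_le_left' one_le_two)
    (add_le_add le_rfl (le_mul_of_one_le_left' one_le_two))

end Shift

/-! ### The ratio limit -/

section Ratio

open scoped ENNReal

variable {d : ℕ} {μ : (Fin d → ℤ) → ℝ}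

theorem exists_le_ofReal_exp {B : ℝ≥0∞} (hB : B ≠ ⊤) :
    ∃ β : ℝ, 0 ≤ β ∧ B ≤ ENNReal.ofReal (Real.exp β) := by
  refine ⟨B.toReal, ENNReal.toReal_nonneg, ?_⟩
  rw [← ENNReal.ofReal_toReal hB]
  refine ENNReal.ofReal_le_ofReal ?_
  rw [ENNReal.toReal_ofReal ENNReal.toReal_nonneg]
  linarith [Real.add_one_le_exp B.toReal]

theorem exists_le_ofReal_exp_neg {ρ : ℝ≥0∞} (hρ : ρ < 1) :
    ∃ l : ℝ, 0 < l ∧ ρ ≤ ENNReal.ofReal (Real.exp (-l)) := by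
  have h1 : ρ.toReal < 1 := by
    simpa using (ENNReal.toReal_lt_toReal hρ.ne_top ENNReal.one_ne_top).2 hρ
  refine ⟨1 - ρ.toReal, by linarith, ?_⟩
  rw [ENNReal.le_ofReal_iff_toReal_le hρ.ne_top (Real.exp_pos _).le]
  linarith [Real.add_one_le_exp (-(1 - ρ.toReal))]

theorem eventually_le_dotZ_mean (hA3 : A3 μ) {xs : ℕ → (Fin d → ℤ)}
    (hnorm : Tendsto (fun n => znorm (xs n)) atTop atTop)
    (hdir : Tendsto (fun n i => (xs n i : ℝ) / znorm (xs n)) atTop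
      (𝓝 (fun i => Mvec μ i / rnorm (Mvec μ)))) :
    ∀ᶠ n in atTop, (∑ i, Mvec μ i ^ 2) / (2 * rnorm (Mvec μ)) * znorm (xs n) ≤
      dotZ (Mvec μ) (xs n) := by
  set M := Mvec μ
  set S := ∑ i, M i ^ 2
  have hm : 0 < rnorm M := rnorm_pos hA3
  have hS : 0 < S := sum_sq_pos hA3
  filter_upwards [eventually_abs_sub_le hnorm hdir
    (show 0 < S / (2 * rnorm M ^ 2) by positivity)] with n hn
  set L := znorm (xs n)
  have h1 : ∑ i, (M i * (L * (M i / rnorm M)) - |M i| * (S / (2 * rnorm M ^ 2) * L)) ≤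
      dotZ M (xs n) := by
    refine Finset.sum_le_sum fun i _ => ?_
    have h2 : M i * (L * (M i / rnorm M) - xs n i) ≤ |M i| * (S / (2 * rnorm M ^ 2) * L) := by
      refine (le_abs_self _).trans ?_
      rw [abs_mul]
      exact mul_le_mul_of_nonneg_left (hn i) (abs_nonneg _)
    linarith
  refine le_trans (le_of_eq ?_) h1
  rw [Finset.sum_sub_distrib, ← Finset.sum_mul]
  have h3 : ∑ i, M i * (L * (M i / rnorm M)) = S * (L / rnorm M) := by
    rw [Finset.sum_mul]
    exact Finset.sum_congr rfl fun i _ => by ring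
  have h4 : ∑ i, |M i| = rnorm M := rfl
  rw [h3, h4]
  field_simp
  ring

theorem eventually_greenE_shift_le_add (hnn : ∀ z, 0 ≤ μ z) (hsum : HasSum μ 1) (hA2 : A2 μ)
    (hA3 : A3 μ) {Λ : Set (Fin d)} (hirr : Irred μ (posDom Λ))
    {xs : ℕ → (Fin d → ℤ)} (hxs : ∀ n, xs n ∈ posDom Λ)
    (hnorm : Tendsto (fun n => znorm (xs n)) atTop atTop)
    (hdir : Tendsto (fun n i => (xs n i : ℝ) / znorm (xs n)) atTop
      (𝓝 (fun i => Mvec μ i / rnorm (Mvec μ))))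
    {w : Fin d → ℤ} (hw : ∀ i ∈ Λ, w i = 0) {σ : ℝ} (hσ : 0 < σ) :
    ∃ δ > 0, ∃ η > 0, ∃ C : ℝ≥0∞, C ≠ ⊤ ∧ ∀ᶠ n in atTop, ∀ x x' : posDom Λ,
      x'.1 = x.1 + w → znorm x.1 < δ * znorm (xs n) →
        greenE μ (posDom Λ) ⟨xs n, hxs n⟩ x' ≤
          ENNReal.ofReal (1 + σ) * greenE μ (posDom Λ) ⟨xs n, hxs n⟩ x +
            C * ENNReal.ofReal (Real.exp (-(η * znorm (xs n)))) := by
  obtain ⟨r, hr, hsr⟩ := exists_summable_exp hnn hsum hA2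
  obtain ⟨k, C, ρ, hC, hρ, H⟩ := exists_greenE_shift_le hnn hsum hirr hw hσ
  set M := Mvec μ with hM
  set S := ∑ i, M i ^ 2 with hSdef
  have hm : 0 < rnorm M := rnorm_pos hA3
  have hS : 0 < S := sum_sq_pos hA3
  set a : Fin d → ℝ := fun i => r / rnorm M * M i with ha
  have har : ∀ i, |a i| ≤ r := by
    intro i
    rw [ha, abs_mul, abs_of_pos (by positivity), div_mul_eq_mul_div, div_le_iff₀ hm]
    exact mul_le_mul_of_nonneg_left (abs_le_rnorm M i) hr.le
  obtain ⟨β, hβ, hB⟩ := exists_le_ofReal_exp (B := 2 * (1 + phiE μ a))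
    (ENNReal.mul_ne_top ENNReal.ofNat_ne_top
      (ENNReal.add_ne_top.2 ⟨ENNReal.one_ne_top, phiE_ne_top hnn hsr har⟩))
  obtain ⟨l, hl, hρl⟩ := exists_le_ofReal_exp_neg hρ
  set θ := r / rnorm M * (S / (2 * rnorm M)) with hθ
  have hθ0 : 0 < θ := by positivity
  set c := θ / (4 * (k * β + 1)) with hc
  have hc0 : 0 < c := by positivity
  have hkc : k * β * c ≤ θ / 4 := by
    have : (k * β + 1) * c = θ / 4 := by
      rw [hc]
      field_simp
    linarith
  refine ⟨θ / (4 * r), by positivity, min (θ / 2) (l * c), lt_min (by positivity) (by positivity),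
    ENNReal.ofReal (Real.exp (r * znorm w)) + C * ENNReal.ofReal (Real.exp l),
    ENNReal.add_ne_top.2 ⟨ENNReal.ofReal_ne_top, ENNReal.mul_ne_top hC ENNReal.ofReal_ne_top⟩, ?_⟩
  filter_upwards [eventually_le_dotZ_mean hA3 hnorm hdir] with n hn x x' hx' hx
  set L := znorm (xs n)
  have hL : 0 ≤ L := znorm_nonneg _
  set N := ⌊c * L⌋₊
  have hN1 : (N : ℝ) ≤ c * L := Nat.floor_le (by positivity)
  have hN2 : c * L < N + 1 := Nat.lt_floor_add_one _
  have hy : θ * L ≤ dotZ a (xs n) := by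
    rw [ha, dotZ_smul, hθ, mul_assoc]
    exact mul_le_mul_of_nonneg_left hn (by positivity)
  have hx'' : dotZ a x' ≤ θ * L / 4 + r * znorm w := by
    have h1 := (le_abs_self _).trans (abs_dotZ_le har x'.1)
    have h2 : znorm x'.1 ≤ θ / (4 * r) * L + znorm w := by
      rw [hx']
      linarith [znorm_add_le x.1 w]
    have h3 : r * (θ / (4 * r) * L + znorm w) = θ * L / 4 + r * znorm w := by
      field_simp
    linarith [mul_le_mul_of_nonneg_left h2 hr.le]
  have hhead : (2 * (1 + phiE μ a)) ^ (k * N) *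
      ENNReal.ofReal (Real.exp (dotZ a x' - dotZ a (xs n))) ≤
        ENNReal.ofReal (Real.exp (r * znorm w)) *
          ENNReal.ofReal (Real.exp (-(min (θ / 2) (l * c) * L))) := by
    refine (mul_le_mul_left (pow_le_pow_left₀ zero_le hB _) _).trans ?_
    rw [← ENNReal.ofReal_pow (Real.exp_pos _).le, ← Real.exp_nat_mul,
      ← ENNReal.ofReal_mul (Real.exp_pos _).le, ← ENNReal.ofReal_mul (Real.exp_pos _).le,
      ← Real.exp_add, ← Real.exp_add]
    refine ENNReal.ofReal_le_ofReal (Real.exp_le_exp.2 ?_)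
    have h1 : min (θ / 2) (l * c) * L ≤ θ / 2 * L :=
      mul_le_mul_of_nonneg_right (min_le_left _ _) hL
    have h2 : ((k * N : ℕ) : ℝ) * β ≤ θ / 4 * L := by
      push_cast
      calc (k * N : ℝ) * β = k * β * N := by ring
        _ ≤ k * β * (c * L) := by gcongr
        _ = k * β * c * L := by ring
        _ ≤ θ / 4 * L := by gcongr
    linarith
  have htail : ρ ^ N ≤ ENNReal.ofReal (Real.exp l) *
      ENNReal.ofReal (Real.exp (-(min (θ / 2) (l * c) * L))) := by
    refine (pow_le_pow_left₀ zero_le hρl _).trans ?_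
    rw [← ENNReal.ofReal_pow (Real.exp_pos _).le, ← Real.exp_nat_mul,
      ← ENNReal.ofReal_mul (Real.exp_pos _).le, ← Real.exp_add]
    refine ENNReal.ofReal_le_ofReal (Real.exp_le_exp.2 ?_)
    have h1 : min (θ / 2) (l * c) * L ≤ l * c * L :=
      mul_le_mul_of_nonneg_right (min_le_right _ _) hL
    have h2 := mul_le_mul_of_nonneg_left hN2.le hl.le
    linarith
  refine (H a N ⟨xs n, hxs n⟩ x x' hx').trans ?_
  refine (add_le_add hhead (add_le_add le_rfl (mul_le_mul_right htail C))).trans (le_of_eq ?_)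
  ring

theorem eventually_greenE_shift_le (hnn : ∀ z, 0 ≤ μ z) (hsum : HasSum μ 1) (hA2 : A2 μ)
    (hA3 : A3 μ) (hirr : Irred μ (posDom (LambdaM μ)))
    {xs : ℕ → (Fin d → ℤ)} (hxs : ∀ n, xs n ∈ posDom (LambdaM μ))
    (hnorm : Tendsto (fun n => znorm (xs n)) atTop atTop)
    (hdir : Tendsto (fun n i => (xs n i : ℝ) / znorm (xs n)) atTop
      (𝓝 (fun i => Mvec μ i / rnorm (Mvec μ))))
    {w : Fin d → ℤ} (hw : ∀ i ∈ LambdaM μ, w i = 0) {σ : ℝ} (hσ : 0 < σ) :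
    ∃ δ > 0, ∀ᶠ n in atTop, ∀ x x' : posDom (LambdaM μ),
      x'.1 = x.1 + w → znorm x.1 < δ * znorm (xs n) →
        greenE μ (posDom (LambdaM μ)) ⟨xs n, hxs n⟩ x' ≤
          ENNReal.ofReal (1 + σ) * greenE μ (posDom (LambdaM μ)) ⟨xs n, hxs n⟩ x := by
  obtain ⟨δ₁, hδ₁, η, hη, C, hC, H₁⟩ := eventually_greenE_shift_le_add hnn hsum hA2 hA3 hirr hxs
    hnorm hdir hw (half_pos hσ)
  obtain ⟨δ₂, hδ₂, H₂⟩ := eventually_exp_le_greenE hnn hsum hA2 hA3 hirr hxs hnorm hdir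
    (half_pos hη)
  have hlim : Tendsto (fun n => C.toReal * Real.exp (-(η / 2 * znorm (xs n)))) atTop (𝓝 0) := by
    simpa using (Real.tendsto_exp_neg_atTop_nhds_zero.comp
      (hnorm.const_mul_atTop (half_pos hη))).const_mul C.toReal
  refine ⟨min δ₁ δ₂, lt_min hδ₁ hδ₂, ?_⟩
  filter_upwards [H₁, H₂, hlim.eventually_le_const (half_pos hσ)] with n h1 h2 h3 x x' hx' hx
  have hL := znorm_nonneg (xs n)
  refine (h1 x x' hx' (hx.trans_le (by gcongr; exact min_le_left _ _))).trans ?_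
  have h4 := h2 x (hx.trans_le (by gcongr; exact min_le_right _ _))
  have h5 : C * ENNReal.ofReal (Real.exp (-(η * znorm (xs n)))) ≤
      ENNReal.ofReal (σ / 2) * greenE μ (posDom (LambdaM μ)) ⟨xs n, hxs n⟩ x := by
    refine le_trans ?_ (mul_le_mul_right h4 _)
    rw [← ENNReal.ofReal_toReal hC, ← ENNReal.ofReal_mul ENNReal.toReal_nonneg,
      ← ENNReal.ofReal_mul (half_pos hσ).le]
    refine ENNReal.ofReal_le_ofReal ?_
    have h6 : -(η * znorm (xs n)) = -(η / 2 * znorm (xs n)) + -(η / 2 * znorm (xs n)) := by ring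
    rw [h6, Real.exp_add, ← mul_assoc]
    gcongr
  refine (add_le_add le_rfl h5).trans (le_of_eq ?_)
  rw [← add_mul, ← ENNReal.ofReal_add (by positivity) (by positivity)]
  ring_nf

theorem greenE_ne_zero {Λ : Set (Fin d)} (hirr : Irred μ (posDom Λ)) (x y : posDom Λ) :
    greenE μ (posDom Λ) y x ≠ 0 := by
  obtain ⟨γ, -, hH⟩ := exists_harnack hirr
  intro h
  have h1 := hH y x y
  rw [h, le_zero_iff, mul_eq_zero, ENNReal.ofReal_eq_zero] at h1
  rcases h1 with h1 | h1
  · exact (Real.exp_pos _).not_ge h1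
  · exact (one_pos.trans_le (one_le_greenE_self μ (posDom Λ) y)).ne' h1

theorem eventually_abs_green_ratio_sub_one_le (hnn : ∀ z, 0 ≤ μ z) (hsum : HasSum μ 1)
    (hA2 : A2 μ) (hA3 : A3 μ) (hirr : Irred μ (posDom (LambdaM μ)))
    {xs : ℕ → (Fin d → ℤ)} (hxs : ∀ n, xs n ∈ posDom (LambdaM μ))
    (hnorm : Tendsto (fun n => znorm (xs n)) atTop atTop)
    (hdir : Tendsto (fun n i => (xs n i : ℝ) / znorm (xs n)) atTop
      (𝓝 (fun i => Mvec μ i / rnorm (Mvec μ))))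
    {w : Fin d → ℤ} (hw : ∀ i ∈ LambdaM μ, w i = 0) {σ : ℝ} (hσ : 0 < σ) :
    ∃ δ > 0, ∀ᶠ n in atTop, ∀ x ∈ posDom (LambdaM μ), znorm x < δ * znorm (xs n) →
      |green μ (posDom (LambdaM μ)) (x + w) (xs n) / green μ (posDom (LambdaM μ)) x (xs n) - 1| ≤
        σ := by
  obtain ⟨δ₁, hδ₁, H₁⟩ := eventually_greenE_shift_le hnn hsum hA2 hA3 hirr hxs hnorm hdir hw hσ
  obtain ⟨δ₂, hδ₂, H₂⟩ := eventually_greenE_shift_le hnn hsum hA2 hA3 hirr hxs hnorm hdir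
    (w := -w) (fun i hi => by simp [hw i hi]) hσ
  obtain ⟨a, ha⟩ := exists_phiE_lt_one hnn hsum hA2 hA3
  refine ⟨min δ₁ (δ₂ / 2), lt_min hδ₁ (half_pos hδ₂), ?_⟩
  filter_upwards [H₁, H₂, (hnorm.const_mul_atTop (half_pos hδ₂)).eventually_ge_atTop (znorm w)]
    with n h1 h2 h3 x hxA hx
  have hL := znorm_nonneg (xs n)
  let y : posDom (LambdaM μ) := ⟨xs n, hxs n⟩
  let u : posDom (LambdaM μ) := ⟨x, hxA⟩
  let v : posDom (LambdaM μ) := ⟨x + w, fun i hi => by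
    rw [Pi.add_apply, hw i hi, add_zero]
    exact hxA i hi⟩
  have e1 := h1 u v rfl (hx.trans_le (by gcongr; exact min_le_left _ _))
  have e2 := h2 v u (by simp [u, v]) (by
    have h4 : znorm x < δ₂ / 2 * znorm (xs n) := hx.trans_le (by gcongr; exact min_le_right _ _)
    have h5 := znorm_add_le x w
    change znorm (x + w) < _
    linarith)
  have hu := greenE_ne_top hnn (posDom (LambdaM μ)) ha u y
  have hv := greenE_ne_top hnn (posDom (LambdaM μ)) ha v y
  have hpos := ENNReal.toReal_pos (greenE_ne_zero hirr u y) hu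
  have r1 := ENNReal.toReal_mono (ENNReal.mul_ne_top ENNReal.ofReal_ne_top hu) e1
  have r2 := ENNReal.toReal_mono (ENNReal.mul_ne_top ENNReal.ofReal_ne_top hv) e2
  rw [ENNReal.toReal_mul, ENNReal.toReal_ofReal (by positivity)] at r1 r2
  have g1 : green μ (posDom (LambdaM μ)) (x + w) (xs n) = _ := green_eq_toReal hnn hsum _ v y
  have g2 : green μ (posDom (LambdaM μ)) x (xs n) = _ := green_eq_toReal hnn hsum _ u y
  rw [g1, g2, abs_le, div_sub_one hpos.ne', le_div_iff₀ hpos, div_le_iff₀ hpos]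
  change (greenE μ (posDom (LambdaM μ)) y v).toReal ≤
    (1 + σ) * (greenE μ (posDom (LambdaM μ)) y u).toReal at r1
  change (greenE μ (posDom (LambdaM μ)) y u).toReal ≤
    (1 + σ) * (greenE μ (posDom (LambdaM μ)) y v).toReal at r2
  constructor <;> nlinarith

theorem limsup_mem_Icc {u : ℕ → ℝ} {a b : ℝ} (h : ∀ᶠ n in atTop, u n ∈ Set.Icc a b) :
    limsup u atTop ∈ Set.Icc a b := by
  have ha : IsBoundedUnder (· ≥ ·) atTop u :=
    isBoundedUnder_of_eventually_ge (h.mono fun _ h => h.1)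
  have hb : IsBoundedUnder (· ≤ ·) atTop u :=
    isBoundedUnder_of_eventually_le (h.mono fun _ h => h.2)
  exact ⟨le_limsup_of_frequently_le (h.mono fun _ h => h.1).frequently hb,
    limsup_le_of_le ha.isCoboundedUnder_le (h.mono fun _ h => h.2)⟩

theorem liminf_mem_Icc {u : ℕ → ℝ} {a b : ℝ} (h : ∀ᶠ n in atTop, u n ∈ Set.Icc a b) :
    liminf u atTop ∈ Set.Icc a b := by
  have ha : IsBoundedUnder (· ≥ ·) atTop u :=
    isBoundedUnder_of_eventually_ge (h.mono fun _ h => h.1)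
  have hb : IsBoundedUnder (· ≤ ·) atTop u :=
    isBoundedUnder_of_eventually_le (h.mono fun _ h => h.2)
  exact ⟨le_liminf_of_le hb.isCoboundedUnder_ge (h.mono fun _ h => h.1),
    liminf_le_of_frequently_le (h.mono fun _ h => h.2).frequently ha⟩

theorem csInf_image_mem_Icc {α : Type*} {f : α → ℝ} {s : Set α} {a b : ℝ} (hs : s.Nonempty)
    (h : ∀ x ∈ s, f x ∈ Set.Icc a b) : sInf (f '' s) ∈ Set.Icc a b := by
  obtain ⟨x, hx⟩ := hs
  have hx' := Set.mem_image_of_mem f hx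
  refine ⟨le_csInf ⟨_, hx'⟩ ?_, (csInf_le ⟨a, ?_⟩ hx').trans (h x hx).2⟩ <;>
  · rintro _ ⟨z, hz, rfl⟩
    exact (h z hz).1

theorem csSup_image_mem_Icc {α : Type*} {f : α → ℝ} {s : Set α} {a b : ℝ} (hs : s.Nonempty)
    (h : ∀ x ∈ s, f x ∈ Set.Icc a b) : sSup (f '' s) ∈ Set.Icc a b := by
  obtain ⟨x, hx⟩ := hs
  have hx' := Set.mem_image_of_mem f hx
  refine ⟨(h x hx).1.trans (le_csSup ⟨b, ?_⟩ hx'), csSup_le ⟨_, hx'⟩ ?_⟩ <;>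
  · rintro _ ⟨z, hz, rfl⟩
    exact (h z hz).2

theorem tendsto_one_of_eventually_mem_Icc {l : Filter ℝ} {F : ℝ → ℝ}
    (h : ∀ σ > 0, ∀ᶠ δ in l, F δ ∈ Set.Icc (1 - σ) (1 + σ)) : Tendsto F l (𝓝 1) := by
  refine Metric.tendsto_nhds.2 fun ε hε => ?_
  filter_upwards [h (ε / 2) (half_pos hε)] with δ hδ
  rw [Real.dist_eq, abs_lt]
  constructor <;> linarith [hδ.1, hδ.2]

end Ratio

theorem statement12 {d : ℕ} (μ : (Fin d → ℤ) → ℝ)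
    (hnn : ∀ z, 0 ≤ μ z) (hsum : HasSum μ 1)
    (hA1 : A1 μ) (hA2 : A2 μ) (hA3 : A3 μ)
    (xs : ℕ → (Fin d → ℤ)) (hxs : ∀ n, xs n ∈ posDom (LambdaM μ))
    (hnorm : Tendsto (fun n => znorm (xs n)) atTop atTop)
    (hdir : Tendsto (fun n i => (xs n i : ℝ) / znorm (xs n)) atTop
      (𝓝 (fun i => Mvec μ i / rnorm (Mvec μ))))
    (w : Fin d → ℤ) (hw : ∀ i ∈ LambdaM μ, w i = 0) :
    Tendsto (fun δ : ℝ =>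
        Filter.liminf (fun n =>
          sInf ((fun x => green μ (posDom (LambdaM μ)) (x + w) (xs n) /
                  green μ (posDom (LambdaM μ)) x (xs n)) ''
                {x | x ∈ posDom (LambdaM μ) ∧ znorm x < δ * znorm (xs n)})) atTop)
      (𝓝[>] (0 : ℝ)) (𝓝 1) ∧
    Tendsto (fun δ : ℝ =>
        Filter.limsup (fun n =>
          sSup ((fun x => green μ (posDom (LambdaM μ)) (x + w) (xs n) /
                  green μ (posDom (LambdaM μ)) x (xs n)) ''
                {x | x ∈ posDom (LambdaM μ) ∧ znorm x < δ * znorm (xs n)})) atTop)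
      (𝓝[>] (0 : ℝ)) (𝓝 1) := by
  have hne : ∀ δ > 0, ∀ᶠ n in atTop,
      {x | x ∈ posDom (LambdaM μ) ∧ znorm x < δ * znorm (xs n)}.Nonempty := fun δ hδ => by
    filter_upwards [(hnorm.const_mul_atTop hδ).eventually_gt_atTop (znorm (1 : Fin d → ℤ))]
      with n hn
    exact ⟨1, fun i _ => one_pos, hn⟩
  have key : ∀ σ > 0, ∀ᶠ δ in 𝓝[>] (0 : ℝ), ∀ᶠ n in atTop,
      {x | x ∈ posDom (LambdaM μ) ∧ znorm x < δ * znorm (xs n)}.Nonempty ∧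
      ∀ x ∈ {x | x ∈ posDom (LambdaM μ) ∧ znorm x < δ * znorm (xs n)},
        green μ (posDom (LambdaM μ)) (x + w) (xs n) / green μ (posDom (LambdaM μ)) x (xs n) ∈
          Set.Icc (1 - σ) (1 + σ) := by
    intro σ hσ
    obtain ⟨δ₀, hδ₀, H⟩ := eventually_abs_green_ratio_sub_one_le hnn hsum hA2 hA3
      (hA1 (LambdaM μ)) hxs hnorm hdir hw hσ
    filter_upwards [Ioo_mem_nhdsGT hδ₀] with δ hδ
    filter_upwards [H, hne δ hδ.1] with n h1 h2
    refine ⟨h2, fun x hx => ?_⟩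
    have hL := znorm_nonneg (xs n)
    have h3 := abs_le.1 (h1 x hx.1 (hx.2.trans_le (by gcongr; exact hδ.2.le)))
    constructor <;> linarith [h3.1, h3.2]
  constructor
  · refine tendsto_one_of_eventually_mem_Icc fun σ hσ => ?_
    filter_upwards [key σ hσ] with δ hδ
    exact liminf_mem_Icc (hδ.mono fun n hn => csInf_image_mem_Icc hn.1 hn.2)
  · refine tendsto_one_of_eventually_mem_Icc fun σ hσ => ?_
    filter_upwards [key σ hσ] with δ hδ
    exact limsup_mem_Icc (hδ.mono fun n hn => csSup_image_mem_Icc hn.1 hn.2)
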